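/- arXiv:1608.03459 — 4 statements merged into one kernel-verified Lean document; each statement's English description precedes it below -/
import Mathlib

section
/- Let k ≥ 1 and 1 ≤ j ≤ k be integers and let ε > 0 be a real number. Then there exists a constant C > 0 such that for every positive integer N, the number of tuples (x₁,…,x_{2^{j-1}}, y₁,…,y_{2^{j-1}}) of positive integers, all at most N, satisfying x₁^k + ⋯ + x_{2^{j-1}}^k = y₁^k + ⋯ + y_{2^{j-1}}^k is at most C·N^{2^j − j + ε}. -/
namespace Hua

open Finset Polynomial

theorem exists_nat_add_one_le_mul_two_rpow {ε : ℝ} (hε : 0 < ε) :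
    ∃ C : ℝ, 1 ≤ C ∧ ∀ a : ℕ, (a : ℝ) + 1 ≤ C * (2 : ℝ) ^ (a * ε) := by
  have hl : 0 < ε * Real.log 2 := mul_pos hε (Real.log_pos one_lt_two)
  refine ⟨max 1 (ε * Real.log 2)⁻¹, le_max_left _ _, fun a => ?_⟩
  have h1 : (a : ℝ) * (ε * Real.log 2) + 1 ≤ (2 : ℝ) ^ (a * ε) := by
    rw [Real.rpow_def_of_pos two_pos]
    convert Real.add_one_le_exp _ using 2
    ring
  have h3 : 1 ≤ max 1 (ε * Real.log 2)⁻¹ * (ε * Real.log 2) := by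
    calc (1 : ℝ) = (ε * Real.log 2)⁻¹ * (ε * Real.log 2) := (inv_mul_cancel₀ hl.ne').symm
      _ ≤ _ := by gcongr; exact le_max_right _ _
  have h4 : (1 : ℝ) ≤ max 1 (ε * Real.log 2)⁻¹ := le_max_left _ _
  calc (a : ℝ) + 1 ≤ a * (max 1 (ε * Real.log 2)⁻¹ * (ε * Real.log 2))
        + max 1 (ε * Real.log 2)⁻¹ := by
        gcongr
        exact le_mul_of_one_le_right (Nat.cast_nonneg a) h3
    _ = max 1 (ε * Real.log 2)⁻¹ * (a * (ε * Real.log 2) + 1) := by ring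
    _ ≤ _ := by gcongr

/-- The divisor bound `d(n) ≪ n ^ ε`. -/
theorem exists_card_divisors_le_mul_rpow {ε : ℝ} (hε : 0 < ε) :
    ∃ C : ℝ, 1 ≤ C ∧ ∀ n : ℕ, n ≠ 0 → (#n.divisors : ℝ) ≤ C * (n : ℝ) ^ ε := by
  obtain ⟨C, hC, hCa⟩ := exists_nat_add_one_le_mul_two_rpow hε
  obtain ⟨B, hB⟩ := exists_nat_ge ((2 : ℝ) ^ ε⁻¹)
  refine ⟨C ^ B, one_le_pow₀ hC, fun n hn => ?_⟩
  have key : ∀ p ∈ n.primeFactors, ((n.factorization p + 1 : ℕ) : ℝ) ≤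
      (if p < B then C else 1) * ((p ^ n.factorization p : ℕ) : ℝ) ^ ε := by
    intro p hp
    set a := n.factorization p
    have hp2 : (2 : ℝ) ≤ p := by exact_mod_cast (Nat.prime_of_mem_primeFactors hp).two_le
    have hrw : ((p ^ a : ℕ) : ℝ) ^ ε = (p : ℝ) ^ (a * ε) := by
      rw [Real.rpow_mul (by positivity), Real.rpow_natCast, Nat.cast_pow]
    rw [hrw, Nat.cast_succ]
    split_ifs with h
    · refine (hCa a).trans ?_
      gcongr
    · have h2 : (2 : ℝ) ≤ (p : ℝ) ^ ε := by
        have hBp : (B : ℝ) ≤ p := by exact_mod_cast not_lt.mp h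
        calc (2 : ℝ) = ((2 : ℝ) ^ ε⁻¹) ^ ε := by
              rw [← Real.rpow_mul two_pos.le, inv_mul_cancel₀ hε.ne', Real.rpow_one]
          _ ≤ (p : ℝ) ^ ε := by gcongr; exact hB.trans hBp
      rw [one_mul, mul_comm, Real.rpow_mul (by positivity), Real.rpow_natCast]
      calc (a : ℝ) + 1 ≤ (2 : ℝ) ^ a := by exact_mod_cast Nat.lt_two_pow_self
        _ ≤ _ := by gcongr
  have hprod : (n : ℝ) ^ ε = ∏ p ∈ n.primeFactors, ((p ^ n.factorization p : ℕ) : ℝ) ^ ε := by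
    rw [Real.finsetProd_rpow _ _ (fun _ _ => by positivity), ← Nat.cast_prod,
      ← Nat.prod_factorization_eq_prod_primeFactors (f := (· ^ ·)),
      Nat.prod_factorization_pow_eq_self hn]
  rw [Nat.card_divisors hn, Nat.cast_prod, hprod]
  refine (prod_le_prod (fun _ _ => by positivity) key).trans ?_
  rw [prod_mul_distrib]
  gcongr
  rw [prod_ite, prod_const, prod_const_one, mul_one]
  refine pow_le_pow_right₀ hC ?_
  calc #{p ∈ n.primeFactors | p < B} ≤ #(range B) :=
        card_le_card fun p hp => by simpa using (mem_filter.mp hp).2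
    _ = B := card_range B

/-- The multiset of values of the `j`-fold differences of `g` on `A`, over all shifts in
`[-N, N]`. -/
noncomputable def weylValues (N : ℕ) : ℕ → Finset ℤ → (ℤ → ℤ) → Multiset ℤ
  | 0, A, g => A.val.map g
  | j + 1, A, g => ∑ h ∈ Icc (-(N : ℤ)) N,
      weylValues N j {x ∈ A | x + h ∈ A} (fun x => g (x + h) - g x)

theorem card_Icc_neg_self (N : ℕ) : #(Icc (-(N : ℤ)) N) = 2 * N + 1 := by
  rw [Int.card_Icc]; omega

theorem card_weylValues_le (N j : ℕ) (A : Finset ℤ) (g : ℤ → ℤ) :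
    (weylValues N j A g).card ≤ (2 * N + 1) ^ j * #A := by
  induction j generalizing A g with
  | zero => simp [weylValues]
  | succ j ih =>
    rw [weylValues, Multiset.card_sum]
    calc _ ≤ ∑ h ∈ Icc (-(N : ℤ)) N, (2 * N + 1) ^ j * #A :=
          sum_le_sum fun h _ => (ih _ _).trans (by gcongr; exact filter_subset _ _)
      _ = _ := by rw [sum_const, card_Icc_neg_self, smul_eq_mul]; ring

theorem dvd_of_mem_weylValues {N j : ℕ} {A : Finset ℤ} {g : ℤ → ℤ} {d v : ℤ}
    (hg : ∀ x, d ∣ g x) (hv : v ∈ weylValues N j A g) : d ∣ v := by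
  induction j generalizing A g with
  | zero =>
    obtain ⟨x, -, rfl⟩ := Multiset.mem_map.mp hv
    exact hg x
  | succ j ih =>
    rw [weylValues, Multiset.mem_sum] at hv
    obtain ⟨h, -, hv⟩ := hv
    exact ih (fun x => dvd_sub (hg _) (hg _)) hv

theorem natDegree_taylor_sub_self (P : ℤ[X]) {h : ℤ} (hh : h ≠ 0) :
    (taylor h P - P).natDegree = P.natDegree - 1 := by
  rcases Nat.eq_zero_or_pos P.natDegree with h0 | hpos
  · rw [eq_C_of_natDegree_eq_zero h0, taylor_C]; simp
  have hP : P ≠ 0 := by rintro rfl; simp at hpos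
  obtain ⟨d, hd⟩ : ∃ d, P.natDegree = d + 1 := ⟨P.natDegree - 1, by omega⟩
  refine le_antisymm ?_ ?_
  · by_cases hz : taylor h P - P = 0
    · simp [hz]
    have := natDegree_lt_natDegree hz
      (degree_sub_lt_left (degree_taylor P h) (by simpa using hP) (leadingCoeff_taylor h P))
    rw [natDegree_taylor] at this
    omega
  · refine le_natDegree_of_ne_zero ?_
    rw [hd, Nat.add_sub_cancel, coeff_sub, taylor_coeff]
    have hdeg : (hasseDeriv d P).natDegree ≤ 1 := by
      have := natDegree_hasseDeriv_le P d
      omega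
    rw [eq_X_add_C_of_natDegree_le_one hdeg]
    simp only [hasseDeriv_coeff, eval_add, eval_mul, eval_C, eval_X]
    have hlc : P.coeff (d + 1) ≠ 0 := by
      rw [← hd]; exact leadingCoeff_ne_zero.mpr hP
    have : ((1 + d).choose d : ℤ) * P.coeff (1 + d) * h
        + ((0 + d).choose d : ℤ) * P.coeff (0 + d) - P.coeff d
        = (d + 1) * P.coeff (d + 1) * h := by
      rw [add_comm 1 d, Nat.choose_succ_self_right]; simp
    rw [this]
    exact mul_ne_zero (mul_ne_zero (by positivity) hlc) hh

theorem count_map_eval_le (A : Finset ℤ) {P : ℤ[X]} (hP : 0 < P.natDegree) (n : ℤ) :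
    (A.val.map fun x => P.eval x).count n ≤ P.natDegree := by
  have hne : P - C n ≠ 0 := by
    intro h
    rw [sub_eq_zero.mp h, natDegree_C] at hP
    exact hP.ne rfl
  rw [Multiset.count_map]
  calc Multiset.card (A.val.filter fun x => n = P.eval x)
      = #{x ∈ A | n = P.eval x} := rfl
    _ ≤ #(P - C n).roots.toFinset := by
        refine card_le_card fun x hx => ?_
        rw [Multiset.mem_toFinset, mem_roots hne, IsRoot.def, eval_sub, eval_C,
          ← (mem_filter.mp hx).2, sub_self]
    _ ≤ Multiset.card (P - C n).roots := Multiset.toFinset_card_le _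
    _ ≤ (P - C n).natDegree := card_roots' _
    _ = P.natDegree := natDegree_sub_C

theorem weylValues_succ_eval (N j : ℕ) (A : Finset ℤ) (P : ℤ[X]) :
    weylValues N (j + 1) A (fun x => P.eval x) = ∑ h ∈ Icc (-(N : ℤ)) N,
      weylValues N j {x ∈ A | x + h ∈ A} (fun x => (taylor h P - P).eval x) := by
  simp only [weylValues, eval_sub, taylor_eval]

theorem count_zero_weylValues_le {N j : ℕ} {A : Finset ℤ} (hA : #A ≤ N) {P : ℤ[X]}
    (hP : j < P.natDegree) :
    (weylValues N j A fun x => P.eval x).count 0 ≤ (j + P.natDegree) * (2 * N + 1) ^ j := by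
  induction j generalizing A P with
  | zero => simpa [weylValues] using count_map_eval_le A hP 0
  | succ j ih =>
    have hA' (h : ℤ) : #{x ∈ A | x + h ∈ A} ≤ N := (card_filter_le _ _).trans hA
    rw [weylValues_succ_eval, Multiset.count_sum',
      ← add_sum_erase _ _ (show (0 : ℤ) ∈ Icc (-(N : ℤ)) N by simp)]
    have h0 : (weylValues N j {x ∈ A | x + 0 ∈ A}
        fun x => (taylor 0 P - P).eval x).count 0 ≤ (2 * N + 1) ^ (j + 1) := by
      refine (Multiset.count_le_card _ _).trans ((card_weylValues_le _ _ _ _).trans ?_)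
      rw [pow_succ]
      gcongr
      have := hA' 0
      omega
    have hs : ∑ h ∈ (Icc (-(N : ℤ)) N).erase 0, (weylValues N j {x ∈ A | x + h ∈ A}
        fun x => (taylor h P - P).eval x).count 0
        ≤ (2 * N + 1) * ((j + P.natDegree) * (2 * N + 1) ^ j) := by
      rw [← card_Icc_neg_self N, ← smul_eq_mul]
      refine (sum_le_card_nsmul _ _ _ fun h hh => ?_).trans
        (Nat.mul_le_mul_right _ (card_erase_le))
      have hdeg := natDegree_taylor_sub_self P (ne_of_mem_erase hh)
      refine (ih (hA' h) (by omega)).trans ?_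
      rw [card_Icc_neg_self]
      gcongr
      omega
    refine (add_le_add h0 hs).trans (le_of_eq ?_)
    ring

theorem count_weylValues_le {N j : ℕ} {A : Finset ℤ} {P : ℤ[X]} (hP : j < P.natDegree)
    {n : ℤ} (hn : n ≠ 0) :
    (weylValues N j A fun x => P.eval x).count n ≤
      P.natDegree * (2 * #n.natAbs.divisors) ^ j := by
  induction j generalizing A P with
  | zero => simpa [weylValues] using count_map_eval_le A hP n
  | succ j ih =>
    rw [weylValues_succ_eval, Multiset.count_sum']
    set D : Finset ℤ := n.natAbs.divisors.image (fun d : ℕ => (d : ℤ)) ∪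
      n.natAbs.divisors.image (fun d : ℕ => -(d : ℤ)) with hD
    have hcard : #D ≤ 2 * #n.natAbs.divisors := by
      rw [two_mul]
      exact (card_union_le _ _).trans (add_le_add card_image_le card_image_le)
    have hmem {h : ℤ} (hh : h ∣ n) : h ∈ D := by
      have : h.natAbs ∈ n.natAbs.divisors :=
        Nat.mem_divisors.mpr ⟨Int.natAbs_dvd_natAbs.mpr hh, Int.natAbs_ne_zero.mpr hn⟩
      rcases Int.natAbs_eq h with h' | h'
      · exact mem_union_left _ (mem_image.mpr ⟨_, this, h'.symm⟩)
      · exact mem_union_right _ (mem_image.mpr ⟨_, this, h'.symm⟩)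
    have hterm (h : ℤ) : (weylValues N j {x ∈ A | x + h ∈ A}
        fun x => (taylor h P - P).eval x).count n ≤
        if h ∈ D then P.natDegree * (2 * #n.natAbs.divisors) ^ j else 0 := by
      by_cases hdvd : h ∣ n
      · have h0 : h ≠ 0 := by rintro rfl; exact hn (zero_dvd_iff.mp hdvd)
        have hdeg := natDegree_taylor_sub_self P h0
        rw [if_pos (hmem hdvd)]
        refine (ih (by omega)).trans ?_
        gcongr
        omega
      · rw [Multiset.count_eq_zero_of_notMem]
        · exact Nat.zero_le _
        refine fun hv => hdvd (dvd_of_mem_weylValues (fun x => ?_) hv)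
        rw [eval_sub, taylor_eval]
        simpa using sub_dvd_eval_sub (x + h) x P
    calc _ ≤ ∑ h ∈ Icc (-(N : ℤ)) N,
          if h ∈ D then P.natDegree * (2 * #n.natAbs.divisors) ^ j else 0 :=
          sum_le_sum fun h _ => hterm h
      _ ≤ #D * (P.natDegree * (2 * #n.natAbs.divisors) ^ j) := by
          rw [← sum_filter, sum_const, smul_eq_mul]
          exact Nat.mul_le_mul_right _ (card_le_card fun h hh => (mem_filter.mp hh).2)
      _ ≤ (2 * #n.natAbs.divisors) * (P.natDegree * (2 * #n.natAbs.divisors) ^ j) := by gcongr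
      _ = _ := by ring

/-- The exponential sum `t ↦ ∑ n ∈ V, e(nt)` of a multiset of frequencies. -/
noncomputable def expSum (V : Multiset ℤ) (t : UnitAddCircle) : ℂ :=
  (V.map fun n => fourier n t).sum

theorem expSum_sum {ι : Type*} (s : Finset ι) (V : ι → Multiset ℤ) (t : UnitAddCircle) :
    expSum (∑ i ∈ s, V i) t = ∑ i ∈ s, expSum (V i) t := by
  classical
  induction s using Finset.induction_on with
  | empty => simp [expSum]
  | insert a s ha ih =>
    rw [sum_insert ha, sum_insert ha, ← ih]
    simp [expSum]

theorem expSum_map (A : Finset ℤ) (g : ℤ → ℤ) (t : UnitAddCircle) :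
    expSum (A.val.map g) t = ∑ x ∈ A, fourier (g x) t := by
  rw [expSum, Multiset.map_map]
  rfl

theorem expSum_eq_sum (V : Multiset ℤ) (t : UnitAddCircle) :
    expSum V t = ∑ n ∈ V.toFinset, (V.count n : ℂ) * fourier n t := by
  simp [expSum, sum_multiset_map_count]

theorem normSq_expSum_map {N : ℕ} {A : Finset ℤ} (hA : A ⊆ Icc 1 (N : ℤ)) (g : ℤ → ℤ)
    (t : UnitAddCircle) :
    ((‖expSum (A.val.map g) t‖ ^ 2 : ℝ) : ℂ) = expSum (weylValues N 1 A g) t := by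
  have hconj : ((‖expSum (A.val.map g) t‖ ^ 2 : ℝ) : ℂ) =
      ∑ x ∈ A, ∑ y ∈ A, fourier (g y - g x) t := by
    rw [Complex.ofReal_pow, ← Complex.conj_mul', expSum_map, map_sum, sum_mul_sum]
    refine sum_congr rfl fun x _ => sum_congr rfl fun y _ => ?_
    rw [← fourier_neg, ← fourier_add, neg_add_eq_sub]
  have hshift : ∀ x ∈ A, ∑ y ∈ A, (fourier (g y - g x) t : ℂ) =
      ∑ h ∈ Icc (-(N : ℤ)) N, if x + h ∈ A then fourier (g (x + h) - g x) t else 0 := by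
    intro x hx
    rw [← sum_filter]
    refine sum_nbij' (fun y => y - x) (fun h => x + h) (fun y hy => ?_) (fun h hh => ?_)
      (fun y _ => by ring) (fun h _ => by ring) (fun y _ => by simp)
    · have h1 := mem_Icc.mp (hA hx)
      have h2 := mem_Icc.mp (hA hy)
      refine mem_filter.mpr ⟨mem_Icc.mpr ⟨by linarith, by linarith⟩, by simpa using hy⟩
    · exact (mem_filter.mp hh).2
  rw [hconj, sum_congr rfl hshift, sum_comm]
  simp only [weylValues, expSum_sum, expSum_map, sum_filter]

/-- Weyl differencing. -/
theorem norm_expSum_pow_le {N : ℕ} {A : Finset ℤ} (hA : A ⊆ Icc 1 (N : ℤ)) (j : ℕ) (g : ℤ → ℤ)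
    (t : UnitAddCircle) :
    ‖expSum (A.val.map g) t‖ ^ 2 ^ (j + 1) ≤
      (2 * N + 1 : ℝ) ^ (2 ^ (j + 1) - (j + 2)) * (expSum (weylValues N (j + 1) A g) t).re := by
  induction j generalizing A g with
  | zero => simp [← normSq_expSum_map hA, -Complex.ofReal_pow]
  | succ j ih =>
    have hA' (h : ℤ) : {x ∈ A | x + h ∈ A} ⊆ Icc 1 (N : ℤ) := (filter_subset _ _).trans hA
    obtain ⟨m, hm⟩ : ∃ m, 2 ^ (j + 1) = m + 1 := ⟨2 ^ (j + 1) - 1, by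
      have := Nat.one_le_two_pow (n := j + 1); omega⟩
    have hjm : j + 1 ≤ m := by
      have := Nat.lt_two_pow_self (n := j + 1); omega
    have h1 : ‖expSum (A.val.map g) t‖ ^ 2 ≤ ∑ h ∈ Icc (-(N : ℤ)) N,
        ‖expSum (({x ∈ A | x + h ∈ A} : Finset ℤ).val.map fun x => g (x + h) - g x) t‖ := by
      rw [← Complex.ofReal_re (‖_‖ ^ 2), normSq_expSum_map hA]
      refine (Complex.re_le_norm _).trans ?_
      simp only [weylValues, expSum_sum]
      exact norm_sum_le _ _
    calc ‖expSum (A.val.map g) t‖ ^ 2 ^ (j + 1 + 1)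
        = (‖expSum (A.val.map g) t‖ ^ 2) ^ (m + 1) := by rw [← pow_mul, pow_succ' 2 (j + 1), hm]
      _ ≤ _ := pow_le_pow_left₀ (by positivity) h1 _
      _ ≤ _ := pow_sum_le_card_mul_sum_pow (fun _ _ => norm_nonneg _) m
      _ ≤ (2 * N + 1 : ℝ) ^ m * ∑ h ∈ Icc (-(N : ℤ)) N, (2 * N + 1 : ℝ) ^ (m - (j + 1)) *
          (expSum (weylValues N (j + 1) {x ∈ A | x + h ∈ A} fun x => g (x + h) - g x) t).re := by
        rw [card_Icc_neg_self]
        push_cast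
        gcongr with h _
        simpa only [hm, Nat.add_sub_add_right] using ih (hA' h) fun x => g (x + h) - g x
      _ = (2 * N + 1 : ℝ) ^ (2 ^ (j + 1 + 1) - (j + 1 + 2)) *
          (expSum (weylValues N (j + 1 + 1) A g) t).re := by
        rw [← mul_sum, ← mul_assoc, ← pow_add, ← Complex.re_sum, ← expSum_sum, pow_succ' 2 (j + 1),
          hm]
        congr 2
        omega

open MeasureTheory AddCircle

theorem integral_fourier (n : ℤ) :
    ∫ t : UnitAddCircle, fourier n t ∂haarAddCircle = if n = 0 then 1 else 0 := by
  have := congrFun (fourierCoeff_fourier (T := 1) n) 0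
  simpa [fourierCoeff, Pi.single_apply, eq_comm] using this

theorem integrable_of_continuous {E : Type*} [NormedAddCommGroup E] {f : UnitAddCircle → E}
    (hf : Continuous f) : Integrable f haarAddCircle :=
  hf.integrable_of_hasCompactSupport (HasCompactSupport.of_compactSpace f)

theorem continuous_expSum (V : Multiset ℤ) : Continuous (expSum V) := by
  simp only [funext (expSum_eq_sum V)]
  fun_prop

theorem integral_expSum_mul_fourier_neg (V : Multiset ℤ) (n : ℤ) :
    ∫ t : UnitAddCircle, expSum V t * fourier (-n) t ∂haarAddCircle = V.count n := by
  simp only [expSum_eq_sum, sum_mul, mul_assoc, ← fourier_add]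
  rw [integral_finsetSum _ fun m _ => integrable_of_continuous (by fun_prop)]
  simp only [integral_const_mul, integral_fourier, ← sub_eq_add_neg, sub_eq_zero]
  simp +contextual

/-- Pairs of `s`-tuples from `A`. -/
abbrev tuplePairs (s : ℕ) (A : Finset ℤ) : Finset ((Fin s → ℤ) × (Fin s → ℤ)) :=
  Fintype.piFinset (fun _ : Fin s => A) ×ˢ Fintype.piFinset (fun _ : Fin s => A)

theorem card_tuplePairs (s : ℕ) (A : Finset ℤ) : #(tuplePairs s A) = #A ^ (2 * s) := by
  simp [card_product, two_mul, pow_add]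

theorem fourier_sum {ι : Type*} (s : Finset ι) (g : ι → ℤ) (t : UnitAddCircle) :
    (fourier (∑ i ∈ s, g i) t : ℂ) = ∏ i ∈ s, fourier (g i) t := by
  classical
  induction s using Finset.induction_on with
  | empty => simp
  | insert a s ha ih => rw [sum_insert ha, prod_insert ha, ← ih, fourier_add]

theorem norm_expSum_map_pow (s : ℕ) (A : Finset ℤ) (g : ℤ → ℤ) (t : UnitAddCircle) :
    ((‖expSum (A.val.map g) t‖ ^ (2 * s) : ℝ) : ℂ) =
      ∑ p ∈ tuplePairs s A, fourier (-(∑ i, g (p.1 i) - ∑ i, g (p.2 i))) t := by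
  rw [pow_mul, Complex.ofReal_pow, Complex.ofReal_pow, ← Complex.conj_mul', mul_pow, ← map_pow,
    expSum_map, sum_pow', map_sum, sum_mul_sum, sum_product]
  refine sum_congr rfl fun x _ => sum_congr rfl fun y _ => ?_
  rw [neg_sub, sub_eq_neg_add, fourier_add, fourier_neg, fourier_sum, fourier_sum]

theorem integral_norm_expSum_map_pow (s : ℕ) (A : Finset ℤ) (g : ℤ → ℤ) :
    ∫ t, ‖expSum (A.val.map g) t‖ ^ (2 * s) ∂haarAddCircle =
      #{p ∈ tuplePairs s A | ∑ i, g (p.1 i) = ∑ i, g (p.2 i)} := by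
  apply Complex.ofReal_injective
  rw [← integral_complex_ofReal]
  simp only [norm_expSum_map_pow]
  rw [integral_finsetSum _ fun m _ => integrable_of_continuous (by fun_prop)]
  simp only [integral_fourier, neg_eq_zero, sub_eq_zero]
  simp

theorem integral_re_expSum_mul_norm_pow (V : Multiset ℤ) (s : ℕ) (A : Finset ℤ) (g : ℤ → ℤ) :
    ∫ t, (expSum V t).re * ‖expSum (A.val.map g) t‖ ^ (2 * s) ∂haarAddCircle =
      ∑ p ∈ tuplePairs s A, (V.count (∑ i, g (p.1 i) - ∑ i, g (p.2 i)) : ℝ) := by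
  have hV := continuous_expSum V
  have hA := continuous_expSum (A.val.map g)
  simp only [← Complex.re_mul_ofReal]
  have hint : Integrable
      (fun t => expSum V t * ((‖expSum (A.val.map g) t‖ ^ (2 * s) : ℝ) : ℂ)) haarAddCircle :=
    integrable_of_continuous (by fun_prop)
  refine (integral_re hint).trans ?_
  simp only [norm_expSum_map_pow, mul_sum]
  rw [integral_finsetSum _ fun m _ => integrable_of_continuous (by fun_prop)]
  simp only [integral_expSum_mul_fourier_neg]
  simp

theorem card_solutions_succ_le {N : ℕ} {A : Finset ℤ} (hA : A ⊆ Icc 1 (N : ℤ)) (j : ℕ)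
    (g : ℤ → ℤ) :
    (#{p ∈ tuplePairs (2 ^ (j + 1)) A | ∑ i, g (p.1 i) = ∑ i, g (p.2 i)} : ℝ) ≤
      (2 * N + 1 : ℝ) ^ (2 ^ (j + 1) - (j + 2)) * ∑ p ∈ tuplePairs (2 ^ j) A,
        ((weylValues N (j + 1) A g).count (∑ i, g (p.1 i) - ∑ i, g (p.2 i)) : ℝ) := by
  have hV := continuous_expSum (weylValues N (j + 1) A g)
  have hf := continuous_expSum (A.val.map g)
  rw [← integral_norm_expSum_map_pow, ← integral_re_expSum_mul_norm_pow, ← integral_const_mul]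
  refine integral_mono (integrable_of_continuous (by fun_prop))
    (integrable_of_continuous (by fun_prop)) fun t => ?_
  dsimp only
  rw [two_mul (2 ^ (j + 1)), pow_add, ← mul_assoc, ← pow_succ']
  gcongr
  exact norm_expSum_pow_le hA j g t

theorem sum_count_weylValues_le {N : ℕ} {A : Finset ℤ} (hA : #A ≤ N) {j s D : ℕ} {P : ℤ[X]}
    (hP : j < P.natDegree)
    (hD : ∀ p ∈ tuplePairs s A, ∑ i, P.eval (p.1 i) ≠ ∑ i, P.eval (p.2 i) →
      #(∑ i, P.eval (p.1 i) - ∑ i, P.eval (p.2 i)).natAbs.divisors ≤ D) :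
    ∑ p ∈ tuplePairs s A, (weylValues N j A fun x => P.eval x).count
        (∑ i, P.eval (p.1 i) - ∑ i, P.eval (p.2 i)) ≤
      #{p ∈ tuplePairs s A | ∑ i, P.eval (p.1 i) = ∑ i, P.eval (p.2 i)} *
        ((j + P.natDegree) * (2 * N + 1) ^ j) + N ^ (2 * s) * (P.natDegree * (2 * D) ^ j) := by
  rw [← sum_filter_add_sum_filter_not _
    (fun p => ∑ i, P.eval (p.1 i) = ∑ i, P.eval (p.2 i))]
  refine add_le_add ?_ ?_
  · rw [← smul_eq_mul]
    refine sum_le_card_nsmul _ _ _ fun p hp => ?_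
    rw [(mem_filter.mp hp).2, sub_self]
    exact count_zero_weylValues_le hA hP
  · refine (sum_le_card_nsmul _ _ (P.natDegree * (2 * D) ^ j) fun p hp => ?_).trans ?_
    · obtain ⟨hp, hne⟩ := mem_filter.mp hp
      refine (count_weylValues_le hP (sub_ne_zero.mpr hne)).trans ?_
      gcongr
      exact hD p hp hne
    · rw [smul_eq_mul]
      refine Nat.mul_le_mul_right _ ((card_filter_le _ _).trans ?_)
      rw [card_tuplePairs]
      exact Nat.pow_le_pow_left hA _

/-- The number of solutions of `x₁^k + ⋯ + x_s^k = y₁^k + ⋯ + y_s^k` in `[1, N]`. -/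
noncomputable abbrev powerSolutions (k s N : ℕ) : ℕ :=
  #{p ∈ tuplePairs s (Icc 1 (N : ℤ)) | ∑ i, p.1 i ^ k = ∑ i, p.2 i ^ k}

theorem natAbs_sum_pow_sub_le {k s N : ℕ} {p : (Fin s → ℤ) × (Fin s → ℤ)}
    (hp : p ∈ tuplePairs s (Icc 1 (N : ℤ))) :
    (∑ i, p.1 i ^ k - ∑ i, p.2 i ^ k).natAbs ≤ s * N ^ k := by
  have aux (x : Fin s → ℤ) (hx : ∀ i, x i ∈ Icc 1 (N : ℤ)) :
      0 ≤ ∑ i, x i ^ k ∧ ∑ i, x i ^ k ≤ s * (N : ℤ) ^ k := by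
    simp only [mem_Icc] at hx
    refine ⟨sum_nonneg fun i _ => pow_nonneg (by linarith [hx i]) _, ?_⟩
    calc ∑ i, x i ^ k ≤ ∑ _i : Fin s, (N : ℤ) ^ k :=
          sum_le_sum fun i _ => pow_le_pow_left₀ (by linarith [hx i]) (hx i).2 _
      _ = s * (N : ℤ) ^ k := by simp
  obtain ⟨h1, h2⟩ := mem_product.mp hp
  have a1 := aux p.1 (Fintype.mem_piFinset.mp h1)
  have a2 := aux p.2 (Fintype.mem_piFinset.mp h2)
  zify
  exact abs_le.mpr ⟨by linarith, by linarith⟩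

theorem powerSolutions_succ_le {k j N D : ℕ} (hjk : j + 1 < k)
    (hD : ∀ n : ℕ, n ≠ 0 → n ≤ 2 ^ j * N ^ k → #n.divisors ≤ D) :
    powerSolutions k (2 ^ (j + 1)) N ≤ (2 * N + 1) ^ (2 ^ (j + 1) - (j + 2)) *
      (powerSolutions k (2 ^ j) N * ((j + 1 + k) * (2 * N + 1) ^ (j + 1)) +
        N ^ 2 ^ (j + 1) * (k * (2 * D) ^ (j + 1))) := by
  have h1 := card_solutions_succ_le (subset_refl (Icc 1 (N : ℤ))) j (· ^ k)
  have h2 := sum_count_weylValues_le (N := N) (A := Icc 1 (N : ℤ)) (by simp) (j := j + 1)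
    (s := 2 ^ j) (D := D) (P := X ^ k) (by simpa using hjk) (fun p hp hne => by
      simp only [eval_pow, eval_X] at hne ⊢
      exact hD _ (Int.natAbs_ne_zero.mpr (sub_ne_zero.mpr hne))
        (by simpa using natAbs_sum_pow_sub_le (k := k) hp))
  simp only [eval_pow, eval_X, natDegree_X_pow, ← pow_succ'] at h2
  refine le_trans (by exact_mod_cast h1) (Nat.mul_le_mul_left _ h2)

theorem powerSolutions_one_le {k : ℕ} (hk : k ≠ 0) (N : ℕ) : powerSolutions k 1 N ≤ N := by
  calc powerSolutions k 1 N ≤ #(Fintype.piFinset fun _ : Fin 1 => Icc 1 (N : ℤ)) := by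
        refine card_le_card_of_injOn Prod.fst (fun p hp => ?_) fun p hp q hq hpq => ?_
        · exact (mem_product.mp (mem_filter.mp hp).1).1
        · have aux {p : (Fin 1 → ℤ) × (Fin 1 → ℤ)}
              (hp : p ∈ {p ∈ tuplePairs 1 (Icc 1 (N : ℤ)) | ∑ i, p.1 i ^ k = ∑ i, p.2 i ^ k}) :
              p.1 = p.2 := by
            obtain ⟨hp, he⟩ := mem_filter.mp hp
            obtain ⟨h1, h2⟩ := mem_product.mp hp
            have h1 := mem_Icc.mp (Fintype.mem_piFinset.mp h1 0)
            have h2 := mem_Icc.mp (Fintype.mem_piFinset.mp h2 0)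
            simp only [Fin.sum_univ_one] at he
            funext i
            rw [Subsingleton.elim i 0]
            exact (pow_left_inj₀ (by linarith) (by linarith) hk).mp he
          exact Prod.ext hpq ((aux hp).symm.trans (hpq.trans (aux hq)))
    _ = N := by simp

theorem exists_card_divisors_le_of_le_mul_pow (K k : ℕ) {ε : ℝ} (hε : 0 < ε) :
    ∃ C : ℝ, 1 ≤ C ∧ ∀ N : ℕ, 0 < N → ∀ n : ℕ, n ≠ 0 → n ≤ K * N ^ k →
      (#n.divisors : ℝ) ≤ C * (N : ℝ) ^ ε := by
  obtain ⟨C, hC, h⟩ := exists_card_divisors_le_mul_rpow (ε := ε / (k + 1)) (by positivity)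
  refine ⟨C * max 1 ((K : ℝ) ^ (ε / (k + 1))), one_le_mul_of_one_le_of_one_le hC (le_max_left _ _),
    fun N hN n hn hnK => (h n hn).trans ?_⟩
  have hN1 : (1 : ℝ) ≤ N := by exact_mod_cast hN
  have hnK' : (n : ℝ) ≤ K * (N : ℝ) ^ k := by exact_mod_cast hnK
  rw [mul_assoc]
  gcongr
  calc (n : ℝ) ^ (ε / (k + 1)) ≤ (K * (N : ℝ) ^ k) ^ (ε / (k + 1)) := by gcongr
    _ = (K : ℝ) ^ (ε / (k + 1)) * (N : ℝ) ^ (k * (ε / (k + 1))) := by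
      rw [Real.mul_rpow (by positivity) (by positivity), Real.rpow_mul (by positivity),
        Real.rpow_natCast]
    _ ≤ _ := by
      gcongr
      · exact le_max_right _ _
      · rw [mul_div_assoc', div_le_iff₀ (by positivity)]
        nlinarith

theorem exists_powerSolutions_le {k : ℕ} (j : ℕ) (hjk : j + 1 ≤ k) {ε : ℝ} (hε : 0 < ε) :
    ∃ C : ℝ, 0 < C ∧ ∀ N : ℕ, 0 < N → (powerSolutions k (2 ^ j) N : ℝ) ≤
      C * (N : ℝ) ^ ((2 : ℝ) ^ (j + 1) - (j + 1) + ε) := by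
  induction j with
  | zero =>
    refine ⟨1, one_pos, fun N hN => ?_⟩
    have hN1 : (1 : ℝ) ≤ N := by exact_mod_cast hN
    calc (powerSolutions k (2 ^ 0) N : ℝ) ≤ N := by
          exact_mod_cast powerSolutions_one_le (by omega) N
      _ = (N : ℝ) ^ (1 : ℝ) := (Real.rpow_one _).symm
      _ ≤ 1 * (N : ℝ) ^ ((2 : ℝ) ^ (0 + 1) - ((0 : ℕ) + 1) + ε) := by
          rw [one_mul]
          exact Real.rpow_le_rpow_of_exponent_le hN1 (by norm_num; linarith)
  | succ j ih =>
    obtain ⟨C, hC, hCN⟩ := ih (by omega)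
    obtain ⟨B, hB, hBN⟩ := exists_card_divisors_le_of_le_mul_pow (2 ^ j) k
      (ε := ε / (j + 1)) (by positivity)
    set m := 2 ^ (j + 1) - (j + 2)
    have hm2 : m + (j + 2) = 2 ^ (j + 1) :=
      Nat.sub_add_cancel (Nat.lt_two_pow_self (n := j + 1))
    refine ⟨3 ^ m * (C * ((j + 1 + k) * 3 ^ (j + 1)) + k * (2 * B) ^ (j + 1)), by positivity,
      fun N hN => ?_⟩
    have hN1 : (1 : ℝ) ≤ N := by exact_mod_cast hN
    have hN0 : (0 : ℝ) < N := by positivity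
    have hN3 : (2 * N + 1 : ℝ) ≤ 3 * N := by linarith
    obtain ⟨D, hD⟩ : ∃ D : ℕ, D = ⌊B * (N : ℝ) ^ (ε / (j + 1))⌋₊ := ⟨_, rfl⟩
    have hDle : (D : ℝ) ≤ B * (N : ℝ) ^ (ε / (j + 1)) := by
      rw [hD]; exact Nat.floor_le (by positivity)
    have h := powerSolutions_succ_le (k := k) (j := j) (N := N) (D := D) (by omega)
      fun n hn hle => by rw [hD]; exact Nat.le_floor (hBN N hN n hn hle)
    have hDpow : (2 * D : ℝ) ^ (j + 1) ≤ (2 * B) ^ (j + 1) * (N : ℝ) ^ ε := by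
      calc (2 * D : ℝ) ^ (j + 1) ≤ (2 * (B * (N : ℝ) ^ (ε / (j + 1)))) ^ (j + 1) := by gcongr
        _ = (2 * B) ^ (j + 1) * ((N : ℝ) ^ (ε / (j + 1))) ^ (j + 1) := by ring
        _ = _ := by
          rw [← Real.rpow_natCast ((N : ℝ) ^ _), ← Real.rpow_mul hN0.le]
          congr 2
          push_cast
          field_simp
    have hmr : (m : ℝ) + (j + 2) = 2 ^ (j + 1) := by exact_mod_cast hm2
    have hNsplit : (N : ℝ) ^ ((2 : ℝ) ^ (j + 1) - (j + 1) + ε) * (N : ℝ) ^ (j + 1) =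
        (N : ℝ) ^ 2 ^ (j + 1) * (N : ℝ) ^ ε := by
      rw [← Real.rpow_natCast (N : ℝ), ← Real.rpow_natCast (N : ℝ),
        ← Real.rpow_add hN0, ← Real.rpow_add hN0]
      congr 1
      push_cast
      ring
    have hNexp : (N : ℝ) ^ m * ((N : ℝ) ^ 2 ^ (j + 1) * (N : ℝ) ^ ε) =
        (N : ℝ) ^ ((2 : ℝ) ^ (j + 1 + 1) - ((j + 1 : ℕ) + 1) + ε) := by
      rw [← Real.rpow_natCast (N : ℝ), ← Real.rpow_natCast (N : ℝ),
        ← Real.rpow_add hN0, ← Real.rpow_add hN0]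
      congr 1
      push_cast
      rw [pow_succ (2 : ℝ) (j + 1)]
      linarith
    calc (powerSolutions k (2 ^ (j + 1)) N : ℝ)
        ≤ (2 * N + 1) ^ m * (powerSolutions k (2 ^ j) N * ((j + 1 + k) * (2 * N + 1) ^ (j + 1)) +
          N ^ 2 ^ (j + 1) * (k * (2 * D) ^ (j + 1))) := by exact_mod_cast h
      _ ≤ (3 * N) ^ m * (C * (N : ℝ) ^ ((2 : ℝ) ^ (j + 1) - (j + 1) + ε) *
          ((j + 1 + k) * (3 * N) ^ (j + 1)) +
          N ^ 2 ^ (j + 1) * (k * ((2 * B) ^ (j + 1) * (N : ℝ) ^ ε))) := by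
        gcongr
        exact hCN N hN
      _ = 3 ^ m * (N : ℝ) ^ m * (C * ((j + 1 + k) * 3 ^ (j + 1)) *
          ((N : ℝ) ^ ((2 : ℝ) ^ (j + 1) - (j + 1) + ε) * (N : ℝ) ^ (j + 1)) +
          k * (2 * B) ^ (j + 1) * ((N : ℝ) ^ 2 ^ (j + 1) * (N : ℝ) ^ ε)) := by
        rw [mul_pow, mul_pow 3]; ring
      _ = 3 ^ m * (C * ((j + 1 + k) * 3 ^ (j + 1)) + k * (2 * B) ^ (j + 1)) *
          ((N : ℝ) ^ m * ((N : ℝ) ^ 2 ^ (j + 1) * (N : ℝ) ^ ε)) := by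
        rw [hNsplit]; ring
      _ = _ := by rw [hNexp]

end Hua

/-- Hua's lemma in solution-counting form: for `1 ≤ j ≤ k` and `ε > 0`, the number of
solutions in `[1,N]` of `x₁^k + ⋯ + x_{2^{j-1}}^k = y₁^k + ⋯ + y_{2^{j-1}}^k` is
`≪ N^{2^j - j + ε}`. -/
theorem stmt4 (k j : ℕ) (hk : 1 ≤ k) (hj : 1 ≤ j) (hjk : j ≤ k)
    (ε : ℝ) (hε : 0 < ε) :
    ∃ C : ℝ, 0 < C ∧ ∀ N : ℕ, 0 < N →
      ((((Fintype.piFinset (fun _ : Fin (2 ^ (j - 1)) => Finset.Icc (1 : ℤ) N)) ×ˢ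
         (Fintype.piFinset (fun _ : Fin (2 ^ (j - 1)) => Finset.Icc (1 : ℤ) N))).filter
          (fun p => ∑ i, p.1 i ^ k = ∑ i, p.2 i ^ k)).card : ℝ) ≤
        C * (N : ℝ) ^ ((2 : ℝ) ^ j - j + ε) := by
  obtain ⟨i, rfl⟩ : ∃ i, j = i + 1 := ⟨j - 1, by omega⟩
  simpa using Hua.exists_powerSolutions_le i hjk hε
end

section
/- Let k ≥ 1 and s ≥ 2^{k−1} be integers and let ε > 0 be a real number. Then there exists a constant C > 0 such that for every positive integer N, the number of tuples (x₁,…,x_s, y₁,…,y_s) of positive integers, all at most N, satisfying x₁^k + ⋯ + x_s^k = y₁^k + ⋯ + y_s^k is at most C·N^{2s − k + ε}. -/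
open Finset Polynomial

/-- The divisor bound `d(n) ≪ n ^ δ`. -/
theorem exists_card_divisors_le_mul_rpow {δ : ℝ} (hδ : 0 < δ) :
    ∃ C : ℝ, 0 < C ∧ ∀ n : ℕ, n ≠ 0 → (n.divisors.card : ℝ) ≤ C * (n : ℝ) ^ δ := by
  set c : ℝ := 2 ^ δ - 1 with hc
  have hc0 : 0 < c := by
    have := Real.one_lt_rpow (x := 2) (by norm_num) hδ
    linarith
  set K : ℝ := 1 + 1 / c with hK
  have hK1 : 1 ≤ K := by
    have : 0 < 1 / c := by positivity
    linarith
  set Q : ℕ := ⌈(2 : ℝ) ^ (1 / δ)⌉₊ with hQ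
  have key (p a : ℕ) (hp : p.Prime) :
      (a : ℝ) + 1 ≤ (if p < Q then K else 1) * ((p : ℝ) ^ a) ^ δ := by
    have hp2 : (2 : ℝ) ≤ p := by exact_mod_cast hp.two_le
    have hpow : ((p : ℝ) ^ a) ^ δ = ((p : ℝ) ^ δ) ^ a := by
      rw [← Real.rpow_natCast, ← Real.rpow_natCast, ← Real.rpow_mul (by positivity),
        ← Real.rpow_mul (by positivity), mul_comm]
    rw [hpow]
    split_ifs with h
    · have h1 : 1 + (a : ℝ) * c ≤ ((p : ℝ) ^ δ) ^ a :=
        (one_add_mul_le_pow (by linarith) a).trans <| by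
          have : (2 : ℝ) ^ δ ≤ (p : ℝ) ^ δ := by gcongr
          gcongr
          linarith
      have h2 : (a : ℝ) + 1 ≤ K * (1 + a * c) := by
        have h3 : K * (1 + a * c) = 1 + a + 1 / c + a * c := by
          rw [hK]; field_simp; ring
        have : 0 < 1 / c := by positivity
        have : 0 ≤ a * c := by positivity
        linarith
      exact h2.trans (by gcongr)
    · rw [one_mul]
      have h1 : (2 : ℝ) ≤ (p : ℝ) ^ δ := by
        have h2 : (2 : ℝ) ^ (1 / δ) ≤ p := (Nat.le_ceil _).trans (by exact_mod_cast not_lt.mp h)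
        calc (2 : ℝ) = ((2 : ℝ) ^ (1 / δ)) ^ δ := by
              rw [← Real.rpow_mul (by norm_num), one_div_mul_cancel hδ.ne', Real.rpow_one]
          _ ≤ _ := by gcongr
      calc (a : ℝ) + 1 ≤ 2 ^ a := by exact_mod_cast Nat.lt_two_pow_self
        _ ≤ _ := by gcongr
  refine ⟨K ^ Q, by positivity, fun n hn => ?_⟩
  have hn' : (n : ℝ) ^ δ = ∏ p ∈ n.primeFactors, ((p : ℝ) ^ n.factorization p) ^ δ := by
    rw [Real.finsetProd_rpow _ _ (fun i _ => by positivity)]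
    conv_lhs => rw [← Nat.prod_factorization_pow_eq_self hn]
    simp [Finsupp.prod]
  rw [Nat.card_divisors hn, hn', Nat.cast_prod]
  calc ∏ p ∈ n.primeFactors, ((n.factorization p + 1 : ℕ) : ℝ)
      ≤ ∏ p ∈ n.primeFactors, (if p < Q then K else 1) * ((p : ℝ) ^ n.factorization p) ^ δ := by
        refine prod_le_prod (fun _ _ => by positivity) fun p hp => ?_
        push_cast
        exact key p _ (Nat.prime_of_mem_primeFactors hp)
    _ = (∏ p ∈ n.primeFactors, (if p < Q then K else 1)) *
          ∏ p ∈ n.primeFactors, ((p : ℝ) ^ n.factorization p) ^ δ := prod_mul_distrib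
    _ ≤ _ := by
        refine mul_le_mul_of_nonneg_right ?_ (prod_nonneg fun _ _ => by positivity)
        rw [prod_ite, prod_const, prod_const_one, mul_one]
        refine pow_le_pow_right₀ hK1 ?_
        calc _ ≤ (range Q).card := card_le_card fun p hp => by
              simpa using (mem_filter.mp hp).2
          _ = Q := card_range Q

/-- The number of elements of `s` dividing `b` is at most twice the number of divisors of `|b|`. -/
lemma card_filter_dvd_le {b : ℤ} (hb : b ≠ 0) (s : Finset ℤ) :
    (s.filter (· ∣ b)).card ≤ 2 * b.natAbs.divisors.card := by
  classical
  have hsub : s.filter (· ∣ b) ⊆ b.natAbs.divisors.image (fun d : ℕ => (d : ℤ)) ∪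
      b.natAbs.divisors.image (fun d : ℕ => -(d : ℤ)) := by
    intro h hh
    have hd : h.natAbs ∈ b.natAbs.divisors := by
      simpa [Int.natAbs_dvd_natAbs, hb] using (mem_filter.mp hh).2
    rcases Int.natAbs_eq h with h1 | h1
    · exact mem_union_left _ (mem_image.mpr ⟨_, hd, h1.symm⟩)
    · exact mem_union_right _ (mem_image.mpr ⟨_, hd, h1.symm⟩)
  calc _ ≤ _ := card_le_card hsub
    _ ≤ _ := card_union_le _ _
    _ ≤ _ := by
      rw [two_mul]
      exact add_le_add card_image_le card_image_le

/-- Differencing a nonconstant polynomial with a nonzero step lowers its degree by one. -/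
lemma natDegree_taylor_sub_self (P : ℤ[X]) {h : ℤ} (hh : h ≠ 0) (hP : 1 ≤ P.natDegree) :
    (taylor h P - P).natDegree = P.natDegree - 1 := by
  obtain ⟨d, hd⟩ : ∃ d, P.natDegree = d + 1 := ⟨P.natDegree - 1, by omega⟩
  have hP0 : P.coeff (d + 1) ≠ 0 := by
    rw [← hd, coeff_natDegree, Ne, leadingCoeff_eq_zero]
    rintro rfl
    simp at hP
  rw [hd, Nat.add_sub_cancel]
  refine natDegree_eq_of_le_of_coeff_ne_zero ?_ ?_
  · refine natDegree_le_iff_coeff_eq_zero.mpr fun n hn => ?_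
    rcases Nat.lt_or_ge (d + 1) n with h1 | h1
    · rw [coeff_eq_zero_of_natDegree_lt]
      refine (natDegree_sub_le _ _).trans_lt ?_
      simpa [natDegree_taylor, hd] using h1
    · obtain rfl : n = d + 1 := by omega
      rw [coeff_sub, ← hd, coeff_taylor_natDegree, coeff_natDegree, sub_self]
  · have h1 : (hasseDeriv d P).natDegree ≤ 1 := (natDegree_hasseDeriv_le P d).trans (by omega)
    obtain ⟨u, v, huv⟩ := exists_eq_X_add_C_of_natDegree_le_one h1
    have hu : u = (d + 1) * P.coeff (d + 1) := by
      have := hasseDeriv_coeff d P 1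
      rw [huv, add_comm 1 d] at this
      simpa [coeff_C, -eq_intCast] using this
    have hv : v = P.coeff d := by
      have := hasseDeriv_coeff d P 0
      rw [huv] at this
      simpa using this
    rw [coeff_sub, taylor_coeff, huv]
    simp only [eval_add, eval_mul, eval_C, eval_X, hu, hv, add_sub_cancel_right]
    exact mul_ne_zero (mul_ne_zero (by positivity) hP0) hh

/-- The sum of `g (Δ_{h₁} ⋯ Δ_{h_j} P (x))` over steps `h_i ∈ (-N, N)` and points `x` such that all
vertices of the parallelepiped spanned by `x` and the `h_i` lie in `A`. -/
noncomputable def diffSum {M : Type*} [AddCommMonoid M] (N : ℕ) (g : ℤ → M) : ℕ → Finset ℤ → ℤ[X] → M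
  | 0, A, P => ∑ x ∈ A, g (P.eval x)
  | j + 1, A, P => ∑ h ∈ Ioo (-(N : ℤ)) N,
      diffSum N g j (A.filter (fun x => x + h ∈ A)) (taylor h P - P)

lemma map_diffSum {M M' : Type*} [AddCommMonoid M] [AddCommMonoid M'] (F : M →+ M') (N : ℕ)
    (g : ℤ → M) (j : ℕ) (A : Finset ℤ) (P : ℤ[X]) :
    F (diffSum N g j A P) = diffSum N (fun n => F (g n)) j A P := by
  induction j generalizing A P with
  | zero => simp [diffSum]
  | succ j ih => simp [diffSum, ih]

lemma card_Ioo_neg_le (N : ℕ) : (((Ioo (-(N : ℤ)) N).card : ℕ) : ℝ) ≤ 2 * N := by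
  rw [Int.card_Ioo]
  have : ((N : ℤ) - -(N : ℤ) - 1).toNat ≤ 2 * N := by omega
  exact_mod_cast this

lemma diffSum_le_of_le_one {N : ℕ} {g : ℤ → ℝ} (hg : ∀ n, g n ≤ 1) (j : ℕ) {A : Finset ℤ}
    (hA : A.card ≤ N) (P : ℤ[X]) : diffSum N g j A P ≤ (2 * N : ℝ) ^ j * N := by
  induction j generalizing A P with
  | zero =>
    calc diffSum N g 0 A P ≤ ∑ _x ∈ A, (1 : ℝ) := sum_le_sum fun _ _ => hg _
      _ ≤ _ := by simpa using hA
  | succ j ih =>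
    calc diffSum N g (j + 1) A P ≤ ∑ _h ∈ Ioo (-(N : ℤ)) N, (2 * N : ℝ) ^ j * N :=
          sum_le_sum fun h _ => ih ((card_filter_le _ _).trans hA) _
      _ = ((Ioo (-(N : ℤ)) N).card : ℝ) * ((2 * N : ℝ) ^ j * N) := by
          rw [sum_const, nsmul_eq_mul]
      _ ≤ (2 * N : ℝ) * ((2 * N : ℝ) ^ j * N) :=
          mul_le_mul_of_nonneg_right (card_Ioo_neg_le N) (by positivity)
      _ = _ := by ring

/-- A nonconstant polynomial takes each value at most `natDegree` times. -/
lemma sum_ite_eval_eq_le (A : Finset ℤ) {P : ℤ[X]} (hP : 1 ≤ P.natDegree) (b : ℤ) :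
    ∑ x ∈ A, (if P.eval x = b then (1 : ℝ) else 0) ≤ P.natDegree := by
  rw [sum_boole]
  have hd : (P - C b).natDegree = P.natDegree := natDegree_sub_C
  have h0 : P - C b ≠ 0 := by
    intro h
    rw [h] at hd
    simp at hd
    omega
  have : (A.filter (fun x => P.eval x = b)).card ≤ P.natDegree := by
    calc _ ≤ (P - C b).roots.toFinset.card := card_le_card fun x hx => by
          simp only [Multiset.mem_toFinset, mem_roots h0, IsRoot.def, eval_sub, eval_C, sub_eq_zero]
          exact (mem_filter.mp hx).2
      _ ≤ (P - C b).roots.card := Multiset.toFinset_card_le _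
      _ ≤ _ := (card_roots' _).trans_eq hd
  exact_mod_cast this

lemma diffSum_ite_zero_le {N : ℕ} (j : ℕ) {A : Finset ℤ} (hA : A.card ≤ N) {P : ℤ[X]}
    (hP : j + 1 ≤ P.natDegree) :
    diffSum N (fun n => if n = 0 then (1 : ℝ) else 0) j A P ≤
      (2 * N : ℝ) ^ j * (P.natDegree + j) := by
  induction j generalizing A P with
  | zero => simpa [diffSum] using sum_ite_eval_eq_le A hP 0
  | succ j ih =>
    set g : ℤ → ℝ := fun n => if n = 0 then (1 : ℝ) else 0
    have hg : ∀ n, g n ≤ 1 := fun n => by simp only [g]; split_ifs <;> norm_num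
    have hfil (h : ℤ) : (A.filter (fun x => x + h ∈ A)).card ≤ N := (card_filter_le _ _).trans hA
    have hd : ((P.natDegree - 1 : ℕ) : ℝ) = P.natDegree - 1 := by
      rw [Nat.cast_sub (by omega), Nat.cast_one]
    have hd0 : (0 : ℝ) ≤ P.natDegree - 1 := hd ▸ Nat.cast_nonneg _
    calc diffSum N g (j + 1) A P
        ≤ ∑ h ∈ Ioo (-(N : ℤ)) N, ((2 * N : ℝ) ^ j * (P.natDegree - 1 + j) +
            if h = 0 then (2 * N : ℝ) ^ j * N else 0) := by
          refine sum_le_sum fun h _ => ?_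
          split_ifs with h0
          · have := diffSum_le_of_le_one hg j (hfil h) (taylor h P - P)
            have : (0 : ℝ) ≤ (2 * N : ℝ) ^ j * (P.natDegree - 1 + j) := by positivity
            linarith
          · have h1 := natDegree_taylor_sub_self P h0 (by omega)
            have h2 := ih (hfil h) (P := taylor h P - P) (by omega)
            rw [h1, hd] at h2
            linarith
      _ ≤ (2 * N : ℝ) * ((2 * N : ℝ) ^ j * (P.natDegree - 1 + j)) + (2 * N : ℝ) ^ j * N := by
          rw [sum_add_distrib, sum_const, nsmul_eq_mul, sum_ite_eq']
          refine add_le_add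
            (mul_le_mul_of_nonneg_right (card_Ioo_neg_le N) (by positivity)) ?_
          split_ifs
          · exact le_rfl
          · positivity
      _ ≤ _ := by
          have : (0 : ℝ) ≤ (2 * N : ℝ) ^ j * N := by positivity
          push_cast
          rw [pow_succ]
          nlinarith

lemma diffSum_ite_eq_zero_of_not_dvd (N : ℕ) {m b : ℤ} (hmb : ¬ m ∣ b) (j : ℕ) (A : Finset ℤ)
    {P : ℤ[X]} (hP : ∀ x, m ∣ P.eval x) :
    diffSum N (fun n => if n = b then (1 : ℝ) else 0) j A P = 0 := by
  induction j generalizing A P with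
  | zero =>
    refine sum_eq_zero fun x _ => if_neg ?_
    rintro rfl
    exact hmb (hP x)
  | succ j ih =>
    refine sum_eq_zero fun h _ => ih _ fun x => ?_
    rw [eval_sub, taylor_eval]
    exact dvd_sub (hP _) (hP _)

lemma diffSum_ite_le {N : ℕ} {b : ℤ} (hb : b ≠ 0) (j : ℕ) (A : Finset ℤ) {P : ℤ[X]}
    (hP : j + 1 ≤ P.natDegree) :
    diffSum N (fun n => if n = b then (1 : ℝ) else 0) j A P ≤
      (((Ioo (-(N : ℤ)) N).filter (· ∣ b)).card : ℝ) ^ j * P.natDegree := by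
  induction j generalizing A P with
  | zero => simpa [diffSum] using sum_ite_eval_eq_le A hP b
  | succ j ih =>
    set D : ℝ := (((Ioo (-(N : ℤ)) N).filter (· ∣ b)).card : ℝ)
    calc diffSum N (fun n => if n = b then (1 : ℝ) else 0) (j + 1) A P
        ≤ ∑ h ∈ Ioo (-(N : ℤ)) N, (if h ∣ b then D ^ j * P.natDegree else 0) := by
          refine sum_le_sum fun h _ => ?_
          split_ifs with hd
          · have h0 : h ≠ 0 := by
              rintro rfl
              exact hb (zero_dvd_iff.mp hd)
            have h1 := natDegree_taylor_sub_self P h0 (by omega)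
            refine (ih _ (P := taylor h P - P) (by omega)).trans ?_
            rw [h1]
            gcongr
            omega
          · refine (diffSum_ite_eq_zero_of_not_dvd N hd j _ fun x => ?_).le
            rw [eval_sub, taylor_eval]
            simpa using sub_dvd_eval_sub (x + h) x P
      _ = D ^ (j + 1) * P.natDegree := by
          rw [← sum_filter, sum_const, nsmul_eq_mul]
          ring

/-- Weyl differencing, first step: the square of an exponential sum over `A ⊆ [1, N]`. -/
lemma normSq_sum_fourier {N : ℕ} {A : Finset ℤ} (hA : A ⊆ Icc 1 (N : ℤ)) (P : ℤ[X])
    (t : UnitAddCircle) :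
    ((‖∑ x ∈ A, fourier (P.eval x) t‖ ^ 2 : ℝ) : ℂ) =
      ∑ h ∈ Ioo (-(N : ℤ)) N, ∑ x ∈ A.filter (fun x => x + h ∈ A),
        fourier ((taylor h P - P).eval x) t := by
  have hx (x : ℤ) (hx : x ∈ A) (F : ℤ → ℂ) :
      ∑ y ∈ A, F y = ∑ h ∈ Ioo (-(N : ℤ)) N, if x + h ∈ A then F (x + h) else 0 := by
    rw [← sum_filter]
    refine sum_nbij' (fun y => y - x) (fun h => x + h) ?_ ?_ ?_ ?_ ?_
    · intro y hy
      have h1 := mem_Icc.mp (hA hx)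
      have h2 := mem_Icc.mp (hA hy)
      simp only [mem_filter, mem_Ioo, add_sub_cancel]
      exact ⟨by omega, hy⟩
    · intro h hh
      exact (mem_filter.mp hh).2
    · simp
    · simp
    · simp
  calc ((‖∑ x ∈ A, fourier (P.eval x) t‖ ^ 2 : ℝ) : ℂ)
      = ∑ x ∈ A, ∑ y ∈ A, fourier (P.eval y - P.eval x) t := by
        push_cast
        rw [← Complex.conj_mul', map_sum, sum_mul_sum]
        refine sum_congr rfl fun x _ => sum_congr rfl fun y _ => ?_
        rw [← fourier_neg, ← fourier_add, neg_add_eq_sub]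
    _ = ∑ x ∈ A, ∑ h ∈ Ioo (-(N : ℤ)) N,
          if x + h ∈ A then fourier (P.eval (x + h) - P.eval x) t else 0 :=
        sum_congr rfl fun x h => hx x h fun y => fourier (P.eval y - P.eval x) t
    _ = _ := by
        rw [sum_comm]
        refine sum_congr rfl fun h _ => ?_
        rw [sum_filter]
        simp only [eval_sub, taylor_eval]

/-- Weyl differencing, iterated. -/
lemma norm_sum_fourier_pow_le {N : ℕ} (i : ℕ) {A : Finset ℤ} (hA : A ⊆ Icc 1 (N : ℤ)) (P : ℤ[X])
    (t : UnitAddCircle) :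
    (2 * N : ℝ) ^ (i + 2) * ‖∑ x ∈ A, fourier (P.eval x) t‖ ^ 2 ^ (i + 1) ≤
      (2 * N : ℝ) ^ 2 ^ (i + 1) * (diffSum N (fun n => fourier n t) (i + 1) A P).re := by
  induction i generalizing A P with
  | zero =>
    have := congrArg Complex.re (normSq_sum_fourier hA P t)
    rw [Complex.ofReal_re] at this
    rw [zero_add, pow_one, zero_add, this]
    exact le_rfl
  | succ i ih =>
    set z : ℤ → ℂ := fun h => ∑ x ∈ A.filter (fun x => x + h ∈ A),
      fourier ((taylor h P - P).eval x) t with hz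
    have hsq : ‖∑ x ∈ A, fourier (P.eval x) t‖ ^ 2 ≤ ∑ h ∈ Ioo (-(N : ℤ)) N, ‖z h‖ := by
      have := congrArg norm (normSq_sum_fourier hA P t)
      rw [Complex.norm_real, Real.norm_of_nonneg (by positivity)] at this
      rw [this]
      exact norm_sum_le _ _
    obtain ⟨r, hr⟩ : ∃ r, 2 ^ (i + 1) = r + 1 :=
      ⟨2 ^ (i + 1) - 1, (Nat.sub_add_cancel Nat.one_le_two_pow).symm⟩
    have hpow : ‖∑ x ∈ A, fourier (P.eval x) t‖ ^ 2 ^ (i + 2) ≤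
        (2 * N : ℝ) ^ r * ∑ h ∈ Ioo (-(N : ℤ)) N, ‖z h‖ ^ 2 ^ (i + 1) := by
      calc ‖∑ x ∈ A, fourier (P.eval x) t‖ ^ 2 ^ (i + 2)
          = (‖∑ x ∈ A, fourier (P.eval x) t‖ ^ 2) ^ 2 ^ (i + 1) := by
            rw [← pow_mul]; congr 1; ring
        _ ≤ (∑ h ∈ Ioo (-(N : ℤ)) N, ‖z h‖) ^ 2 ^ (i + 1) := by gcongr
        _ ≤ ((Ioo (-(N : ℤ)) N).card : ℝ) ^ r * ∑ h ∈ Ioo (-(N : ℤ)) N, ‖z h‖ ^ 2 ^ (i + 1) := by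
            rw [hr]
            exact pow_sum_le_card_mul_sum_pow (fun _ _ => norm_nonneg _) r
        _ ≤ _ := by
            refine mul_le_mul_of_nonneg_right ?_ (by positivity)
            exact pow_le_pow_left₀ (Nat.cast_nonneg _) (card_Ioo_neg_le N) _
    calc (2 * N : ℝ) ^ (i + 1 + 2) * ‖∑ x ∈ A, fourier (P.eval x) t‖ ^ 2 ^ (i + 1 + 1)
        ≤ (2 * N : ℝ) ^ (i + 1 + 2) *
            ((2 * N : ℝ) ^ r * ∑ h ∈ Ioo (-(N : ℤ)) N, ‖z h‖ ^ 2 ^ (i + 1)) := by gcongr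
      _ = (2 * N : ℝ) ^ 2 ^ (i + 1) *
            ∑ h ∈ Ioo (-(N : ℤ)) N, (2 * N : ℝ) ^ (i + 2) * ‖z h‖ ^ 2 ^ (i + 1) := by
          rw [← mul_sum, hr]; ring
      _ ≤ (2 * N : ℝ) ^ 2 ^ (i + 1) * ∑ h ∈ Ioo (-(N : ℤ)) N, (2 * N : ℝ) ^ 2 ^ (i + 1) *
            (diffSum N (fun n => fourier n t) (i + 1) (A.filter (fun x => x + h ∈ A))
              (taylor h P - P)).re := by
          refine mul_le_mul_of_nonneg_left (sum_le_sum fun h _ => ?_) (by positivity)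
          exact ih ((filter_subset _ _).trans hA) _
      _ = _ := by
          rw [← mul_sum, ← mul_assoc, ← pow_add, ← two_mul, ← pow_succ',
            show i + 1 + 1 = (i + 1) + 1 from rfl, diffSum, Complex.re_sum]

open MeasureTheory in
/-- The real part of the mean value over the circle. -/
noncomputable def reMean : C(UnitAddCircle, ℂ) →+ ℝ :=
  AddMonoidHom.mk' (fun F => (∫ t, F t ∂AddCircle.haarAddCircle).re) fun F G => by
    have hi (F : C(UnitAddCircle, ℂ)) : Integrable F AddCircle.haarAddCircle :=
      F.continuous.integrable_of_hasCompactSupport (HasCompactSupport.of_compactSpace _)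
    simp only [ContinuousMap.add_apply]
    rw [integral_add (hi F) (hi G), Complex.add_re]

open MeasureTheory in
lemma reMean_eq (F : C(UnitAddCircle, ℂ)) :
    reMean F = ∫ t, (F t).re ∂AddCircle.haarAddCircle :=
  (integral_re (𝕜 := ℂ)
    (F.continuous.integrable_of_hasCompactSupport (HasCompactSupport.of_compactSpace _))).symm

open MeasureTheory in
lemma mul_reMean_le {F G : C(UnitAddCircle, ℂ)} {a b : ℝ}
    (h : ∀ t, a * (F t).re ≤ b * (G t).re) : a * reMean F ≤ b * reMean G := by
  rw [reMean_eq, reMean_eq, ← integral_const_mul, ← integral_const_mul]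
  have hi (F : C(UnitAddCircle, ℂ)) (a : ℝ) :
      Integrable (fun t => a * (F t).re) AddCircle.haarAddCircle :=
    Continuous.integrable_of_hasCompactSupport (by fun_prop) (HasCompactSupport.of_compactSpace _)
  exact integral_mono (hi F a) (hi G b) h

lemma reMean_fourier (n : ℤ) : reMean (fourier n) = if n = 0 then 1 else 0 := by
  have h := congrFun (fourierCoeff_fourier (T := 1) n) 0
  simp only [fourierCoeff, neg_zero, fourier_zero, one_smul] at h
  change (∫ t, fourier n t ∂AddCircle.haarAddCircle).re = _
  rw [h]
  by_cases hn : n = 0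
  · simp [hn]
  · simp [hn, eq_comm]

lemma fourier_add_eq_mul (m n : ℤ) :
    (fourier (m + n) : C(UnitAddCircle, ℂ)) = fourier m * fourier n := by
  ext t
  exact fourier_add

/-- Pairs of `m`-tuples with entries in `[1, N]`. -/
noncomputable def tuplePairs (m N : ℕ) : Finset ((Fin m → ℤ) × (Fin m → ℤ)) :=
  Fintype.piFinset (fun _ : Fin m => Icc (1 : ℤ) N) ×ˢ
    Fintype.piFinset (fun _ : Fin m => Icc (1 : ℤ) N)

/-- The difference of the two sums of `k`-th powers. -/
def powDiff (k : ℕ) {m : ℕ} (p : (Fin m → ℤ) × (Fin m → ℤ)) : ℤ :=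
  ∑ i, p.2 i ^ k - ∑ i, p.1 i ^ k

lemma card_tuplePairs (m N : ℕ) : (tuplePairs m N).card = N ^ (2 * m) := by
  simp [tuplePairs, two_mul, pow_add]

lemma abs_powDiff_le {k m N : ℕ} {p : (Fin m → ℤ) × (Fin m → ℤ)} (hp : p ∈ tuplePairs m N) :
    |powDiff k p| ≤ m * (N : ℤ) ^ k := by
  obtain ⟨h1, h2⟩ := mem_product.mp hp
  have key (x : Fin m → ℤ) (hx : x ∈ Fintype.piFinset (fun _ : Fin m => Icc (1 : ℤ) N)) :
      0 ≤ ∑ i, x i ^ k ∧ ∑ i, x i ^ k ≤ m * (N : ℤ) ^ k := by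
    have hx' (i : Fin m) : 1 ≤ x i ∧ x i ≤ N := mem_Icc.mp (Fintype.mem_piFinset.mp hx i)
    refine ⟨sum_nonneg fun i _ => pow_nonneg (by linarith [hx' i]) _, ?_⟩
    calc ∑ i, x i ^ k ≤ ∑ _i : Fin m, (N : ℤ) ^ k :=
          sum_le_sum fun i _ => pow_le_pow_left₀ (by linarith [hx' i]) (hx' i).2 _
      _ = _ := by simp
  have := key _ h1
  have := key _ h2
  rw [powDiff, abs_le]
  constructor <;> linarith

/-- The number of solutions in `[1, N]` of `x₁ ^ k + ⋯ + x_m ^ k = y₁ ^ k + ⋯ + y_m ^ k`. -/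
noncomputable def solutionCount (k m N : ℕ) : ℕ :=
  ((tuplePairs m N).filter fun p => powDiff k p = 0).card

/-- The Weyl sum. -/
noncomputable def weylSum (k N : ℕ) : C(UnitAddCircle, ℂ) :=
  ∑ x ∈ Icc (1 : ℤ) N, fourier (x ^ k)

lemma norm_weylSum_le (k N : ℕ) (t : UnitAddCircle) : ‖weylSum k N t‖ ≤ N := by
  rw [weylSum, ContinuousMap.sum_apply]
  refine (norm_sum_le _ _).trans ?_
  simp [fourier_apply, Circle.norm_coe]

lemma star_mul_self_pow_apply_re (F : C(UnitAddCircle, ℂ)) (m : ℕ) (t : UnitAddCircle) :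
    (((star F * F) ^ m) t).re = ‖F t‖ ^ (2 * m) := by
  have : ((star F * F) ^ m) t = ((‖F t‖ ^ (2 * m) : ℝ) : ℂ) := by
    simp only [ContinuousMap.pow_apply, ContinuousMap.mul_apply, ContinuousMap.star_apply]
    rw [Complex.star_def, Complex.conj_mul', ← pow_mul]
    push_cast
    rfl
  rw [this, Complex.ofReal_re]

lemma weylSum_pow (k m N : ℕ) :
    (star (weylSum k N) * weylSum k N) ^ m = ∑ p ∈ tuplePairs m N, fourier (powDiff k p) := by
  have hprod (a : Fin m → ℤ) :
      ∏ i, (fourier (a i) : C(UnitAddCircle, ℂ)) = fourier (∑ i, a i) := by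
    induction (univ : Finset (Fin m)) using Finset.induction_on with
    | empty => ext t; simp
    | insert i s hi ih => rw [prod_insert hi, sum_insert hi, ih, fourier_add_eq_mul]
  have hpow (g : ℤ → ℤ) : (∑ x ∈ Icc (1 : ℤ) N, (fourier (g x) : C(UnitAddCircle, ℂ))) ^ m =
      ∑ x ∈ Fintype.piFinset (fun _ : Fin m => Icc (1 : ℤ) N), fourier (∑ i, g (x i)) := by
    have := prod_univ_sum (fun _ : Fin m => Icc (1 : ℤ) N)
      (fun _ x => (fourier (g x) : C(UnitAddCircle, ℂ)))
    rw [prod_const, card_univ, Fintype.card_fin] at this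
    rw [this]
    exact sum_congr rfl fun x _ => hprod _
  have hstar : star (weylSum k N) = ∑ x ∈ Icc (1 : ℤ) N, fourier (-x ^ k) := by
    rw [weylSum, star_sum]
    refine sum_congr rfl fun x _ => ?_
    ext t
    rw [fourier_neg]
    rfl
  rw [mul_pow, hstar, hpow (fun x => -x ^ k), weylSum, hpow (fun x => x ^ k), sum_mul_sum,
    tuplePairs, sum_product]
  refine sum_congr rfl fun x _ => sum_congr rfl fun y _ => ?_
  rw [← fourier_add_eq_mul, powDiff, sum_neg_distrib, neg_add_eq_sub]

lemma reMean_weylSum_pow (k m N : ℕ) :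
    reMean ((star (weylSum k N) * weylSum k N) ^ m) = solutionCount k m N := by
  rw [weylSum_pow, map_sum, solutionCount]
  simp only [reMean_fourier]
  rw [sum_boole]

lemma solutionCount_le_mul (k m r N : ℕ) :
    (solutionCount k (m + r) N : ℝ) ≤ (N : ℝ) ^ (2 * r) * solutionCount k m N := by
  rw [← reMean_weylSum_pow, ← reMean_weylSum_pow, ← one_mul (reMean _)]
  refine mul_reMean_le fun t => ?_
  rw [star_mul_self_pow_apply_re, star_mul_self_pow_apply_re, one_mul, mul_add, pow_add, mul_comm]
  gcongr
  exact norm_weylSum_le k N t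

/-- The even moment of order `2 ^ (i + 2)` in terms of the one of order `2 ^ (i + 1)` and
`(i + 1)`-fold differencing. -/
lemma pow_mul_solutionCount_le_sum_diffSum (k i N : ℕ) :
    (2 * N : ℝ) ^ (i + 2) * solutionCount k (2 ^ (i + 1)) N ≤
      (2 * N : ℝ) ^ 2 ^ (i + 1) * ∑ p ∈ tuplePairs (2 ^ i) N,
        diffSum N (fun n => if n = -powDiff k p then (1 : ℝ) else 0) (i + 1) (Icc 1 (N : ℤ))
          (X ^ k) := by
  set S : C(UnitAddCircle, ℂ) := diffSum N (fun n => fourier n) (i + 1) (Icc 1 (N : ℤ)) (X ^ k)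
  have hS (t : UnitAddCircle) :
      S t = diffSum N (fun n => fourier n t) (i + 1) (Icc 1 (N : ℤ)) (X ^ k) :=
    map_diffSum (AddMonoidHom.mk' (fun F : C(UnitAddCircle, ℂ) => F t) fun _ _ => rfl) N _ _ _ _
  have hR : ∑ p ∈ tuplePairs (2 ^ i) N,
        diffSum N (fun n => if n = -powDiff k p then (1 : ℝ) else 0) (i + 1) (Icc 1 (N : ℤ))
          (X ^ k) = reMean (S * (star (weylSum k N) * weylSum k N) ^ 2 ^ i) := by
    rw [weylSum_pow, mul_sum, map_sum]
    refine sum_congr rfl fun p _ => ?_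
    have := map_diffSum (reMean.comp (AddMonoidHom.mulRight (fourier (powDiff k p)))) N
      (fun n => (fourier n : C(UnitAddCircle, ℂ))) (i + 1) (Icc 1 (N : ℤ)) (X ^ k)
    simp only [AddMonoidHom.comp_apply, AddMonoidHom.coe_mulRight, ← fourier_add_eq_mul,
      reMean_fourier, add_eq_zero_iff_eq_neg] at this
    exact this.symm
  rw [hR, ← reMean_weylSum_pow]
  refine mul_reMean_le fun t => ?_
  have hw : weylSum k N t = ∑ x ∈ Icc 1 (N : ℤ), fourier ((X ^ k : ℤ[X]).eval x) t := by
    simp [weylSum]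
  have hmul : ((S * (star (weylSum k N) * weylSum k N) ^ 2 ^ i) t).re =
      (S t).re * ‖weylSum k N t‖ ^ 2 ^ (i + 1) := by
    rw [pow_succ' 2 i, ← star_mul_self_pow_apply_re, ContinuousMap.mul_apply, Complex.mul_re]
    have : (((star (weylSum k N) * weylSum k N) ^ 2 ^ i) t).im = 0 := by
      simp only [ContinuousMap.pow_apply, ContinuousMap.mul_apply, ContinuousMap.star_apply]
      rw [Complex.star_def, Complex.conj_mul']
      norm_cast
    rw [this, mul_zero, sub_zero]
  have h := norm_sum_fourier_pow_le i (subset_refl (Icc 1 (N : ℤ))) (X ^ k) t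
  rw [← hw, ← hS] at h
  rw [hmul, star_mul_self_pow_apply_re, ← pow_succ' 2, pow_succ 2 (i + 1), mul_two,
    pow_add ‖weylSum k N t‖, ← mul_assoc, ← mul_assoc]
  gcongr

/-- The recursive inequality behind the Hua lemma, for a divisor bound `B`. -/
lemma pow_mul_solutionCount_le {k i N : ℕ} (hik : i + 2 ≤ k) {B : ℝ}
    (hB : ∀ b : ℤ, b ≠ 0 → |b| ≤ 2 ^ i * (N : ℤ) ^ k →
      (((Ioo (-(N : ℤ)) N).filter (· ∣ b)).card : ℝ) ≤ B) :
    (2 * N : ℝ) ^ (i + 2) * solutionCount k (2 ^ (i + 1)) N ≤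
      (2 * N : ℝ) ^ 2 ^ (i + 1) *
        (solutionCount k (2 ^ i) N * ((2 * N : ℝ) ^ (i + 1) * (k + (i + 1))) +
          N ^ 2 ^ (i + 1) * (|B| ^ (i + 1) * k)) := by
  refine (pow_mul_solutionCount_le_sum_diffSum k i N).trans ?_
  refine mul_le_mul_of_nonneg_left ?_ (by positivity)
  have hdeg : (X ^ k : ℤ[X]).natDegree = k := natDegree_X_pow k
  calc ∑ p ∈ tuplePairs (2 ^ i) N,
        diffSum N (fun n => if n = -powDiff k p then (1 : ℝ) else 0) (i + 1) (Icc 1 (N : ℤ)) (X ^ k)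
      ≤ ∑ p ∈ tuplePairs (2 ^ i) N,
        ((if powDiff k p = 0 then (2 * N : ℝ) ^ (i + 1) * (k + (i + 1)) else 0) +
          |B| ^ (i + 1) * k) := by
        refine sum_le_sum fun p hp => ?_
        split_ifs with h0
        · have := diffSum_ite_zero_le (N := N) (i + 1) (A := Icc 1 (N : ℤ)) (by simp)
            (P := X ^ k) (by omega)
          rw [hdeg] at this
          push_cast at this
          rw [h0, neg_zero]
          exact this.trans (le_add_of_nonneg_right (by positivity))
        · have := diffSum_ite_le (N := N) (neg_ne_zero.mpr h0) (i + 1) (Icc 1 (N : ℤ))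
            (P := X ^ k) (by omega)
          rw [hdeg] at this
          rw [zero_add]
          refine this.trans ?_
          gcongr
          refine (hB _ (neg_ne_zero.mpr h0) ?_).trans (le_abs_self B)
          rw [abs_neg]
          exact_mod_cast abs_powDiff_le (k := k) hp
    _ = _ := by
        rw [sum_add_distrib, ← sum_filter, sum_const, sum_const, card_tuplePairs, nsmul_eq_mul,
          nsmul_eq_mul, solutionCount, pow_succ' 2 i]
        push_cast
        rfl

lemma solutionCount_one_le {k : ℕ} (hk : k ≠ 0) (N : ℕ) : solutionCount k 1 N ≤ N := by
  calc solutionCount k 1 N ≤ (Fintype.piFinset (fun _ : Fin 1 => Icc (1 : ℤ) N)).card := by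
        refine card_le_card_of_injOn Prod.fst (fun p hp => ?_) fun p hp q hq hpq => ?_
        · exact (mem_product.mp (mem_filter.mp hp).1).1
        · have key (p : (Fin 1 → ℤ) × (Fin 1 → ℤ))
              (hp : p ∈ (tuplePairs 1 N).filter fun p => powDiff k p = 0) : p.2 = p.1 := by
            obtain ⟨h1, h2⟩ := mem_filter.mp hp
            have hpos (x : Fin 1 → ℤ)
                (hx : x ∈ Fintype.piFinset (fun _ : Fin 1 => Icc (1 : ℤ) N)) : 0 ≤ x 0 := by
              have := mem_Icc.mp (Fintype.mem_piFinset.mp hx 0)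
              omega
            have h3 : p.2 0 ^ k = p.1 0 ^ k := by simpa [powDiff, sub_eq_zero] using h2
            have h4 := (pow_left_inj₀ (hpos _ (mem_product.mp h1).2)
              (hpos _ (mem_product.mp h1).1) hk).mp h3
            ext i
            rw [Subsingleton.elim i 0, h4]
          exact Prod.ext hpq (by rw [key p hp, key q hq, hpq])
    _ = N := by simp

/-- The Hua lemma. -/
theorem exists_pow_mul_solutionCount_le {k i : ℕ} (hik : i + 1 ≤ k) {ε : ℝ} (hε : 0 < ε) :
    ∃ C : ℝ, 0 < C ∧ ∀ N : ℕ, 0 < N →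
      (N : ℝ) ^ (i + 1) * solutionCount k (2 ^ i) N ≤ C * (N : ℝ) ^ 2 ^ (i + 1) * (N : ℝ) ^ ε := by
  induction i with
  | zero =>
    refine ⟨1, one_pos, fun N hN => ?_⟩
    have h1 : (solutionCount k (2 ^ 0) N : ℝ) ≤ N := by
      exact_mod_cast solutionCount_one_le (by omega) N
    have h2 : 1 ≤ (N : ℝ) ^ ε := Real.one_le_rpow (by exact_mod_cast hN) hε.le
    calc (N : ℝ) ^ (0 + 1) * solutionCount k (2 ^ 0) N ≤ (N : ℝ) ^ (0 + 1) * N := by gcongr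
      _ = 1 * (N : ℝ) ^ 2 ^ (0 + 1) * 1 := by ring
      _ ≤ _ := by gcongr
  | succ i ih =>
    obtain ⟨C, hC, hR⟩ := ih (by omega)
    have hk0 : (0 : ℝ) < k := by exact_mod_cast (by omega : 0 < k)
    set δ : ℝ := ε / (k * (i + 1)) with hδ
    have hδ0 : 0 < δ := by positivity
    obtain ⟨c, hc, hdiv⟩ := exists_card_divisors_le_mul_rpow hδ0
    set c₁ : ℝ := (2 * c * ((2 : ℝ) ^ i) ^ δ) ^ (i + 1)
    refine ⟨2 ^ 2 ^ (i + 1) * (2 ^ (i + 1) * C * (k + (i + 1)) + c₁ * k), by positivity,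
      fun N hN => ?_⟩
    set B : ℝ := 2 * c * ((2 : ℝ) ^ i * (N : ℝ) ^ k) ^ δ with hBdef
    have hB (b : ℤ) (hb : b ≠ 0) (hbN : |b| ≤ 2 ^ i * (N : ℤ) ^ k) :
        (((Ioo (-(N : ℤ)) N).filter (· ∣ b)).card : ℝ) ≤ B := by
      have h1 : (b.natAbs : ℝ) ≤ 2 ^ i * (N : ℝ) ^ k := by
        rw [Nat.cast_natAbs]
        exact_mod_cast hbN
      calc (((Ioo (-(N : ℤ)) N).filter (· ∣ b)).card : ℝ) ≤ 2 * b.natAbs.divisors.card := by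
            exact_mod_cast card_filter_dvd_le hb _
        _ ≤ 2 * (c * (b.natAbs : ℝ) ^ δ) := by
            gcongr
            exact hdiv _ (Int.natAbs_ne_zero.mpr hb)
        _ ≤ 2 * (c * ((2 : ℝ) ^ i * (N : ℝ) ^ k) ^ δ) := by gcongr
        _ = B := by rw [hBdef]; ring
    have hBpow : |B| ^ (i + 1) = c₁ * (N : ℝ) ^ ε := by
      have h1 : (((N : ℝ) ^ k) ^ δ) ^ (i + 1) = (N : ℝ) ^ ε := by
        rw [← Real.rpow_natCast, ← Real.rpow_natCast, ← Real.rpow_mul (by positivity),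
          ← Real.rpow_mul (by positivity), hδ]
        congr 1
        push_cast
        field_simp
      rw [abs_of_nonneg (by positivity), hBdef, Real.mul_rpow (by positivity) (by positivity),
        ← mul_assoc, mul_pow, h1]
    calc (N : ℝ) ^ (i + 1 + 1) * solutionCount k (2 ^ (i + 1)) N
        ≤ (2 * N : ℝ) ^ (i + 2) * solutionCount k (2 ^ (i + 1)) N := by
          gcongr
          exact le_mul_of_one_le_left (by positivity) one_le_two
      _ ≤ (2 * N : ℝ) ^ 2 ^ (i + 1) *
            (solutionCount k (2 ^ i) N * ((2 * N : ℝ) ^ (i + 1) * (k + (i + 1))) +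
              N ^ 2 ^ (i + 1) * (|B| ^ (i + 1) * k)) := pow_mul_solutionCount_le (by omega) hB
      _ = (2 * N : ℝ) ^ 2 ^ (i + 1) *
            (2 ^ (i + 1) * (k + (i + 1)) * ((N : ℝ) ^ (i + 1) * solutionCount k (2 ^ i) N) +
              N ^ 2 ^ (i + 1) * (c₁ * (N : ℝ) ^ ε * k)) := by
          rw [hBpow, mul_pow (2 : ℝ) N (i + 1)]; ring
      _ ≤ (2 * N : ℝ) ^ 2 ^ (i + 1) *
            (2 ^ (i + 1) * (k + (i + 1)) * (C * (N : ℝ) ^ 2 ^ (i + 1) * (N : ℝ) ^ ε) +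
              N ^ 2 ^ (i + 1) * (c₁ * (N : ℝ) ^ ε * k)) := by
          refine mul_le_mul_of_nonneg_left (add_le_add_left ?_ _) (by positivity)
          exact mul_le_mul_of_nonneg_left (hR N hN) (by positivity)
      _ = _ := by
          rw [mul_pow, pow_succ 2 (i + 1), mul_two, pow_add (N : ℝ) (2 ^ (i + 1))]
          ring

/-- For `s ≥ 2^{k-1}` and `ε > 0`, the number of solutions in `[1,N]` of
`x₁^k + ⋯ + x_s^k = y₁^k + ⋯ + y_s^k` is `≪ N^{2s - k + ε}`. -/
theorem stmt5 (k s : ℕ) (hk : 1 ≤ k) (hs : 2 ^ (k - 1) ≤ s)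
    (ε : ℝ) (hε : 0 < ε) :
    ∃ C : ℝ, 0 < C ∧ ∀ N : ℕ, 0 < N →
      ((((Fintype.piFinset (fun _ : Fin s => Finset.Icc (1 : ℤ) N)) ×ˢ
         (Fintype.piFinset (fun _ : Fin s => Finset.Icc (1 : ℤ) N))).filter
          (fun p => ∑ i, p.1 i ^ k = ∑ i, p.2 i ^ k)).card : ℝ) ≤
        C * (N : ℝ) ^ (2 * (s : ℝ) - k + ε) := by
  obtain ⟨j, rfl⟩ : ∃ j, k = j + 1 := ⟨k - 1, by omega⟩
  rw [Nat.add_sub_cancel] at hs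
  obtain ⟨r, rfl⟩ := Nat.exists_eq_add_of_le hs
  obtain ⟨C, hC, hbound⟩ := exists_pow_mul_solutionCount_le (le_refl (j + 1)) hε
  refine ⟨C, hC, fun N hN => ?_⟩
  have hN0 : (0 : ℝ) < N := by exact_mod_cast hN
  have hcount : (((Fintype.piFinset (fun _ : Fin (2 ^ j + r) => Icc (1 : ℤ) N)) ×ˢ
      (Fintype.piFinset (fun _ : Fin (2 ^ j + r) => Icc (1 : ℤ) N))).filter
        (fun p => ∑ i, p.1 i ^ (j + 1) = ∑ i, p.2 i ^ (j + 1))).card =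
      solutionCount (j + 1) (2 ^ j + r) N := by
    rw [solutionCount, tuplePairs]
    congr 1
    refine filter_congr fun p _ => ?_
    rw [powDiff, sub_eq_zero, eq_comm]
  rw [hcount]
  have hrpow : (N : ℝ) ^ (2 * ((2 ^ j + r : ℕ) : ℝ) - (j + 1 : ℕ) + ε) =
      (N : ℝ) ^ (2 * r) * (N : ℝ) ^ 2 ^ (j + 1) * (N : ℝ) ^ ε / (N : ℝ) ^ (j + 1) := by
    rw [Real.rpow_add hN0, Real.rpow_sub hN0, Real.rpow_natCast,
      show 2 * ((2 ^ j + r : ℕ) : ℝ) = ((2 * r + 2 ^ (j + 1) : ℕ) : ℝ) by push_cast; ring,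
      Real.rpow_natCast, pow_add]
    ring
  rw [hrpow, mul_div_assoc', le_div_iff₀ (by positivity)]
  calc (solutionCount (j + 1) (2 ^ j + r) N : ℝ) * (N : ℝ) ^ (j + 1)
      ≤ (N : ℝ) ^ (2 * r) * solutionCount (j + 1) (2 ^ j) N * (N : ℝ) ^ (j + 1) := by
        gcongr
        exact solutionCount_le_mul _ _ _ _
    _ = (N : ℝ) ^ (2 * r) * ((N : ℝ) ^ (j + 1) * solutionCount (j + 1) (2 ^ j) N) := by ring
    _ ≤ (N : ℝ) ^ (2 * r) * (C * (N : ℝ) ^ 2 ^ (j + 1) * (N : ℝ) ^ ε) :=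
        mul_le_mul_of_nonneg_left (hbound N hN) (by positivity)
    _ = _ := by ring
end

section
/- Let r, m be positive integers, let a₁,…,a_r be integers and q₁,…,q_r positive integers, and suppose there is a nonzero integer tuple (x⁰₁,…,x⁰_r) with a₁(x⁰₁)^{q₁} + ⋯ + a_r(x⁰_r)^{q_r} = 0. Let d₁,…,d_m be integers, p₁,…,p_m positive integers, e an integer, and suppose there is an integer tuple (y⁰₁,…,y⁰_m) with d₁(y⁰₁)^{p₁} + ⋯ + d_m(y⁰_m)^{p_m} + e = 0. Then the set of integer tuples (x₁,…,x_r, y₁,…,y_m) satisfying a₁x₁^{q₁} + ⋯ + a_rx_r^{q_r} + d₁y₁^{p₁} + ⋯ + d_my_m^{p_m} + e = 0 is infinite. -/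
/-- Weighted rescaling preserves the zeros of a diagonal form with arbitrary exponents. -/
theorem sum_mul_weighted_smul_pow_eq_zero {ι R : Type*} [Fintype ι] [DecidableEq ι]
    [CommSemiring R] {a x : ι → R} {q : ι → ℕ} (h : ∑ i, a i * x i ^ q i = 0) (u : R) :
    ∑ i, a i * (u ^ (∏ j ∈ Finset.univ.erase i, q j) * x i) ^ q i = 0 := by
  have key : ∀ i, a i * (u ^ (∏ j ∈ Finset.univ.erase i, q j) * x i) ^ q i =
      u ^ (∏ j, q j) * (a i * x i ^ q i) := by
    intro i
    rw [mul_pow, ← pow_mul, Finset.prod_erase_mul _ _ (Finset.mem_univ i)]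
    ring
  simp only [key, ← Finset.mul_sum, h, mul_zero]

/-- If the diagonal part `a₁x₁^{q₁} + ⋯ + a_rx_r^{q_r} = 0` has a nontrivial integer
solution and the Thue part `d₁y₁^{p₁} + ⋯ + d_my_m^{p_m} + e = 0` has an integer
solution, then the full equation has infinitely many integer solutions. -/
theorem stmt15 (r m : ℕ) (hr : 0 < r) (hm : 0 < m)
    (a : Fin r → ℤ) (q : Fin r → ℕ) (hq : ∀ i, 0 < q i)
    (x0 : Fin r → ℤ) (hx0 : x0 ≠ 0)
    (hx0eq : ∑ i, a i * x0 i ^ q i = 0)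
    (d : Fin m → ℤ) (p : Fin m → ℕ) (hp : ∀ j, 0 < p j) (e : ℤ)
    (y0 : Fin m → ℤ) (hy0 : ∑ j, d j * y0 j ^ p j + e = 0) :
    {z : (Fin r → ℤ) × (Fin m → ℤ) |
      ∑ i, a i * z.1 i ^ q i + ∑ j, d j * z.2 j ^ p j + e = 0}.Infinite := by
  obtain ⟨k, hk⟩ := Function.ne_iff.mp hx0
  refine Set.infinite_of_injective_forall_mem
    (f := fun n : ℕ ↦ (fun i ↦ (n : ℤ) ^ (∏ j ∈ Finset.univ.erase i, q j) * x0 i, y0))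
    (fun n n' h ↦ ?_) (fun n ↦ ?_)
  · have hpow := mul_right_cancel₀ hk (congrFun (congrArg Prod.fst h) k)
    have hexp : (∏ j ∈ Finset.univ.erase k, q j) ≠ 0 :=
      Finset.prod_ne_zero_iff.mpr fun j _ ↦ (hq j).ne'
    exact Nat.pow_left_injective hexp (by exact_mod_cast hpow)
  · simp only [Set.mem_ofPred_eq]
    rw [sum_mul_weighted_smul_pow_eq_zero hx0eq, zero_add, hy0]
end

section
/- For every real ξ > 0 there exists a constant C > 0 such that for every positive integer N, the number of integer triples (x₁, x₂, x₃) with |x₁| ≤ N, |x₂| ≤ N, |x₃| ≤ N satisfying x₁³ + x₂³ + x₃³ = 1 is at most C·N^{1+ξ}. -/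
theorem Nat.card_divisors_le_mul_rpow {ε : ℝ} (hε : 0 < ε) :
    ∃ C : ℝ, 0 < C ∧ ∀ n : ℕ, n ≠ 0 → (n.divisors.card : ℝ) ≤ C * (n : ℝ) ^ ε := by
  set K : ℝ := max 1 (1 / (ε * Real.log 2)) with hK
  set P : ℕ := ⌈(2 : ℝ) ^ (1 / ε)⌉₊ with hP
  have hlog : 0 < ε * Real.log 2 := mul_pos hε (Real.log_pos one_lt_two)
  have hK1 : 1 ≤ K := le_max_left _ _
  have hK2 : 1 ≤ K * (ε * Real.log 2) := by
    rw [← div_le_iff₀ hlog]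
    exact le_max_right _ _
  refine ⟨K ^ P, by positivity, fun n hn => ?_⟩
  have local_bound : ∀ p ∈ n.primeFactors, ((n.factorization p + 1 : ℕ) : ℝ) ≤
      (if p < P then K else 1) * (((p ^ n.factorization p : ℕ) : ℝ) ^ ε) := by
    intro p hp
    have hp2 : (2 : ℝ) ≤ p := by exact_mod_cast (Nat.prime_of_mem_primeFactors hp).two_le
    set a := n.factorization p
    have hpow : (((p ^ a : ℕ) : ℝ) ^ ε) = ((p : ℝ) ^ ε) ^ a := by
      push_cast
      rw [← Real.rpow_natCast, ← Real.rpow_natCast, ← Real.rpow_mul (by positivity),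
        ← Real.rpow_mul (by positivity), mul_comm]
    rw [hpow]
    split_ifs with h
    · have h1 : 1 + ε * Real.log 2 ≤ (p : ℝ) ^ ε := by
        calc 1 + ε * Real.log 2 ≤ Real.exp (ε * Real.log 2) := by
              linarith [Real.add_one_le_exp (ε * Real.log 2)]
          _ = (2 : ℝ) ^ ε := by rw [Real.rpow_def_of_pos two_pos, mul_comm]
          _ ≤ (p : ℝ) ^ ε := by gcongr
      have h2 : 1 + (a : ℝ) * (ε * Real.log 2) ≤ ((p : ℝ) ^ ε) ^ a :=
        (one_add_mul_le_pow (by linarith) a).trans (by gcongr)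
      calc ((a + 1 : ℕ) : ℝ) = 1 + a * 1 := by push_cast; ring
        _ ≤ K + a * (K * (ε * Real.log 2)) := by gcongr
        _ = K * (1 + a * (ε * Real.log 2)) := by ring
        _ ≤ K * ((p : ℝ) ^ ε) ^ a := by gcongr
    · have h1 : (2 : ℝ) ≤ (p : ℝ) ^ ε := by
        calc (2 : ℝ) = ((2 : ℝ) ^ (1 / ε)) ^ ε := by
              rw [← Real.rpow_mul two_pos.le, one_div_mul_cancel hε.ne', Real.rpow_one]
          _ ≤ (p : ℝ) ^ ε := by
              gcongr
              exact (Nat.le_ceil _).trans (by exact_mod_cast not_lt.mp h)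
      calc ((a + 1 : ℕ) : ℝ) ≤ ((2 ^ a : ℕ) : ℝ) := by exact_mod_cast Nat.lt_two_pow_self
        _ ≤ 1 * ((p : ℝ) ^ ε) ^ a := by push_cast; rw [one_mul]; gcongr
  have hprod : ∏ p ∈ n.primeFactors, (((p ^ n.factorization p : ℕ) : ℝ) ^ ε) = (n : ℝ) ^ ε := by
    rw [Real.finsetProd_rpow _ _ (fun _ _ => by positivity), ← Nat.cast_prod]
    congr 2
    exact Nat.prod_factorization_pow_eq_self hn
  have hsmall : ∏ p ∈ n.primeFactors, (if p < P then K else 1) ≤ K ^ P := by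
    rw [← Finset.prod_filter, Finset.prod_const]
    refine pow_le_pow_right₀ hK1 ?_
    calc (n.primeFactors.filter (· < P)).card ≤ (Finset.range P).card :=
          Finset.card_le_card fun p hp => by simpa using (Finset.mem_filter.mp hp).2
      _ = P := Finset.card_range P
  rw [Nat.card_divisors hn, Nat.cast_prod]
  calc ∏ p ∈ n.primeFactors, ((n.factorization p + 1 : ℕ) : ℝ)
      ≤ ∏ p ∈ n.primeFactors,
          (if p < P then K else 1) * (((p ^ n.factorization p : ℕ) : ℝ) ^ ε) :=
        Finset.prod_le_prod (fun _ _ => by positivity) local_bound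
    _ ≤ K ^ P * (n : ℝ) ^ ε := by
        rw [Finset.prod_mul_distrib, hprod]
        gcongr

theorem Int.eq_of_add_eq_of_cube_add_cube_eq {y z y' z' m : ℤ} (hm : m ≠ 0)
    (h : y ^ 3 + z ^ 3 = m) (h' : y' ^ 3 + z' ^ 3 = m) (hs : y + z = y' + z')
    (hle : y ≤ z ↔ y' ≤ z') : y = y' ∧ z = z' := by
  have hs0 : y + z ≠ 0 := by
    intro h0
    apply hm
    rw [← h]
    linear_combination (y ^ 2 - y * z + z ^ 2) * h0
  have hsq : (y - z) ^ 2 = (y' - z') ^ 2 := by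
    have h3 : 3 * (y + z) * ((y - z) ^ 2 - (y' - z') ^ 2) = 0 := by
      linear_combination 4 * h - 4 * h' - ((y + z) ^ 2 + (y + z) * (y' + z') + (y' + z') ^ 2
        + 3 * (y' - z') ^ 2) * hs
    have := (mul_eq_zero.mp h3).resolve_left (mul_ne_zero three_ne_zero hs0)
    linarith
  rcases sq_eq_sq_iff_eq_or_eq_neg.mp hsq with h1 | h1 <;> omega

theorem Int.card_le_four_mul_card_divisors_of_cube_add_cube_eq {m : ℤ} (hm : m ≠ 0)
    (T : Finset (ℤ × ℤ)) (hT : ∀ q ∈ T, q.1 ^ 3 + q.2 ^ 3 = m) :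
    T.card ≤ 4 * m.natAbs.divisors.card := by
  have hcard : (m.natAbs.divisors ×ˢ (Finset.univ : Finset (Bool × Bool))).card =
      4 * m.natAbs.divisors.card := by
    rw [Finset.card_product, mul_comm]
    simp
  rw [← hcard]
  refine Finset.card_le_card_of_injOn
    (fun q => ((q.1 + q.2).natAbs, decide (0 ≤ q.1 + q.2), decide (q.1 ≤ q.2))) ?_ ?_
  · intro q hq
    simp only [Finset.coe_product, Set.mem_prod, Finset.mem_coe, Nat.mem_divisors,
      Finset.mem_univ, and_true]
    refine ⟨Int.natAbs_dvd_natAbs.mpr ⟨q.1 ^ 2 - q.1 * q.2 + q.2 ^ 2, ?_⟩,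
      Int.natAbs_ne_zero.mpr hm⟩
    rw [← hT q hq]
    ring
  · rintro ⟨y, z⟩ hq ⟨y', z'⟩ hq' heq
    simp only [Prod.mk.injEq, decide_eq_decide] at heq ⊢
    exact Int.eq_of_add_eq_of_cube_add_cube_eq hm (hT _ hq) (hT _ hq') (by omega) heq.2.2

/-- For every `ξ > 0`, the number of integer solutions of `x₁³ + x₂³ + x₃³ = 1` in the
hypercube `[-N, N]³` is `≪ N^{1+ξ}`. -/
theorem stmt17 (ξ : ℝ) (hξ : 0 < ξ) :
    ∃ C : ℝ, 0 < C ∧ ∀ N : ℕ, 0 < N →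
      ((((Finset.Icc (-(N : ℤ)) N) ×ˢ (Finset.Icc (-(N : ℤ)) N) ×ˢ
          (Finset.Icc (-(N : ℤ)) N)).filter
        (fun p => p.1 ^ 3 + p.2.1 ^ 3 + p.2.2 ^ 3 = 1)).card : ℝ) ≤
      C * (N : ℝ) ^ (1 + ξ) := by
  obtain ⟨D, hD, hdiv⟩ := Nat.card_divisors_le_mul_rpow (ε := ξ / 3) (by positivity)
  refine ⟨3 + 3 * (4 * (D * 2 ^ (ξ / 3))), by positivity, fun N hN => ?_⟩
  set I := Finset.Icc (-(N : ℤ)) N with hI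
  set S := (I ×ˢ I ×ˢ I).filter (fun p => p.1 ^ 3 + p.2.1 ^ 3 + p.2.2 ^ 3 = 1) with hS
  have hmem : ∀ p ∈ S, (p.1 ∈ I ∧ p.2.1 ∈ I ∧ p.2.2 ∈ I) ∧
      p.1 ^ 3 + p.2.1 ^ 3 + p.2.2 ^ 3 = 1 := fun p hp => by
    simpa only [hS, Finset.mem_filter, Finset.mem_product] using hp
  have hN1 : (1 : ℝ) ≤ N := by exact_mod_cast hN
  have hIcard : (I.card : ℝ) ≤ 3 * N := by
    have : I.card ≤ 3 * N := by
      rw [hI, Int.card_Icc]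
      omega
    exact_mod_cast this
  have hline : ((S.filter (fun p => p.1 = 1)).card : ℝ) ≤ 3 * N := by
    refine le_trans ?_ hIcard
    rw [Nat.cast_le]
    refine Finset.card_le_card_of_injOn (fun p => p.2.1) (fun p hp => ?_) ?_
    · exact (hmem p (Finset.mem_filter.mp hp).1).1.2.1
    · rintro ⟨x, y, z⟩ hp ⟨x', y', z'⟩ hp' hy
      obtain ⟨h1, rfl⟩ := Finset.mem_filter.mp hp
      obtain ⟨h1', hx'⟩ := Finset.mem_filter.mp hp'
      have h2 := (hmem _ h1).2
      have h2' := (hmem _ h1').2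
      simp only at hy hx' h2 h2'
      subst hy hx'
      have hz : z ^ 3 = z' ^ 3 := by linarith
      rw [(Odd.strictMono_pow (by decide : Odd 3)).injective hz]
  have hfiber : ∀ x ∈ I, (((S.filter (fun p => ¬ p.1 = 1)).filter (fun p => p.1 = x)).card : ℝ) ≤
      4 * (D * 2 ^ (ξ / 3)) * (N : ℝ) ^ ξ := by
    intro x hx
    set F := (S.filter (fun p => ¬ p.1 = 1)).filter (fun p => p.1 = x) with hF
    by_cases hx1 : x = 1
    · have : F = ∅ := by
        rw [hF, Finset.filter_filter, Finset.filter_eq_empty_iff]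
        rintro p - ⟨h, h'⟩
        exact h (h'.trans hx1)
      rw [this, Finset.card_empty, Nat.cast_zero]
      positivity
    have hmemF : ∀ p ∈ F, p ∈ S ∧ p.1 = x := fun p hp =>
      ⟨(Finset.mem_filter.mp (Finset.mem_filter.mp hp).1).1, (Finset.mem_filter.mp hp).2⟩
    have hm : 1 - x ^ 3 ≠ 0 := by
      intro h
      apply hx1
      exact (Odd.strictMono_pow (by decide : Odd 3)).injective
        (show x ^ 3 = 1 ^ 3 by linarith)
    have hinj : Set.InjOn Prod.snd (F : Set (ℤ × ℤ × ℤ)) := fun p hp q hq h =>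
      Prod.ext ((hmemF p hp).2.trans (hmemF q hq).2.symm) h
    have hcard := Int.card_le_four_mul_card_divisors_of_cube_add_cube_eq hm (F.image Prod.snd) (by
      intro q hq
      obtain ⟨p, hp, rfl⟩ := Finset.mem_image.mp hq
      have := (hmem p (hmemF p hp).1).2
      rw [(hmemF p hp).2] at this
      linarith)
    rw [Finset.card_image_of_injOn hinj] at hcard
    have habs : ((1 - x ^ 3).natAbs : ℝ) ≤ 2 * (N : ℝ) ^ 3 := by
      have hxN : |(x : ℝ)| ≤ N := by
        rw [hI, Finset.mem_Icc] at hx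
        exact_mod_cast abs_le.mpr hx
      have h1 : |(1 : ℝ) - (x : ℝ) ^ 3| ≤ 1 + |(x : ℝ)| ^ 3 := by
        rw [← abs_pow]
        simpa only [abs_one] using abs_sub (1 : ℝ) ((x : ℝ) ^ 3)
      have h2 : |(x : ℝ)| ^ 3 ≤ (N : ℝ) ^ 3 := by gcongr
      have h3 : (1 : ℝ) ≤ (N : ℝ) ^ 3 := one_le_pow₀ hN1
      rw [Nat.cast_natAbs]
      push_cast
      linarith
    calc (F.card : ℝ) ≤ 4 * ((1 - x ^ 3).natAbs.divisors.card : ℝ) := by exact_mod_cast hcard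
      _ ≤ 4 * (D * ((1 - x ^ 3).natAbs : ℝ) ^ (ξ / 3)) := by
          gcongr
          exact hdiv _ (Int.natAbs_ne_zero.mpr hm)
      _ ≤ 4 * (D * (2 * (N : ℝ) ^ 3) ^ (ξ / 3)) := by gcongr
      _ = 4 * (D * 2 ^ (ξ / 3)) * (N : ℝ) ^ ξ := by
          rw [Real.mul_rpow (by positivity) (by positivity), ← Real.rpow_natCast,
            ← Real.rpow_mul (by positivity), Nat.cast_ofNat, mul_div_cancel₀ ξ three_ne_zero]
          ring
  have hoff : ((S.filter (fun p => ¬ p.1 = 1)).card : ℝ) ≤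
      3 * N * (4 * (D * 2 ^ (ξ / 3)) * (N : ℝ) ^ ξ) := by
    rw [Finset.card_eq_sum_card_fiberwise (f := Prod.fst) (t := I)
      (fun p hp => (hmem p (Finset.mem_filter.mp hp).1).1.1), Nat.cast_sum]
    refine (Finset.sum_le_card_nsmul _ _ _ hfiber).trans ?_
    rw [nsmul_eq_mul]
    gcongr
  rw [← Finset.card_filter_add_card_filter_not (s := S) (fun p => p.1 = 1), Nat.cast_add,
    Real.rpow_add (by positivity), Real.rpow_one]
  have hNξ : (1 : ℝ) ≤ (N : ℝ) ^ ξ := Real.one_le_rpow hN1 hξ.le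
  calc _ ≤ 3 * (N : ℝ) * 1 + 3 * N * (4 * (D * 2 ^ (ξ / 3)) * (N : ℝ) ^ ξ) := by
        rw [mul_one]
        exact add_le_add hline hoff
    _ ≤ 3 * (N : ℝ) * (N : ℝ) ^ ξ + 3 * N * (4 * (D * 2 ^ (ξ / 3)) * (N : ℝ) ^ ξ) := by gcongr
    _ = _ := by ring
end
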